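/- Let σ be a distortion function and p ∈ (1,∞) with conjugate exponent q. Then |·|*_{σ,q} is a norm on L*_{σ,q}(P) turning it into a Banach space; the map Φ : (L*_{σ,q}(P), |·|*_{σ,q}) → (L_σ^p(P)*, ‖·‖*), Φ(Z)(Y) := E(ZY), is an isometric isomorphism onto the continuous dual of L_σ^p(P); and every φ ∈ L_σ^p(P)* attains its norm: there is Y ∈ L_σ^p(P) with ‖Y‖_{σ,p} = 1 and φ(Y) = ‖φ‖*. -/

import Mathlib

open MeasureTheory
open scoped ENNReal NNReal

noncomputable section

variable {Ω : Type*} [MeasurableSpace Ω]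

/-- A `[0,1]`-valued random variable uniformly distributed on `[0,1]`:
`P(U ≤ u) = u` for all `u ∈ [0,1]`. -/
def IsUniformRV (P : Measure Ω) (U : Ω → ℝ) : Prop :=
  Measurable U ∧ (∀ ω, U ω ∈ Set.Icc (0 : ℝ) 1) ∧
    ∀ u ∈ Set.Icc (0 : ℝ) 1, P {ω | U ω ≤ u} = ENNReal.ofReal u

/-- A distortion function: nondecreasing, nonnegative, left-continuous on `[0,1)`
with `∫₀¹ σ(u) du = 1`. -/
structure IsDistortion (σ : ℝ → ℝ) : Prop where
  nonneg : ∀ u ∈ Set.Ico (0 : ℝ) 1, 0 ≤ σ u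
  mono : MonotoneOn σ (Set.Ico (0 : ℝ) 1)
  left_continuous : ∀ u ∈ Set.Ioo (0 : ℝ) 1,
    Filter.Tendsto σ (nhdsWithin u (Set.Iio u)) (nhds (σ u))
  integral_one : ∫ u in Set.Ioo (0 : ℝ) 1, σ u = 1

/-- `‖Y‖_{σ,p}^p := sup over uniform U of E[σ(U)·‖Y‖^p]`. -/
def sigmaPow (P : Measure Ω) (σ : ℝ → ℝ) (p : ℝ) {X : Type*} [NormedAddCommGroup X]
    (Y : Ω → X) : ℝ≥0∞ :=
  ⨆ (U : Ω → ℝ) (_ : IsUniformRV P U),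
    ∫⁻ ω, ENNReal.ofReal (σ (U ω)) * (‖Y ω‖₊ : ℝ≥0∞) ^ p ∂P

/-- The norm `‖Y‖_{σ,p}`. -/
def sigmaNorm (P : Measure Ω) (σ : ℝ → ℝ) (p : ℝ) {X : Type*} [NormedAddCommGroup X]
    (Y : Ω → X) : ℝ≥0∞ :=
  sigmaPow P σ p Y ^ (1 / p)

/-- Membership in `L_σ^p(P,X)`: strongly measurable with finite `σ,p`-norm. -/
def MemLsigma (P : Measure Ω) (σ : ℝ → ℝ) (p : ℝ) {X : Type*} [NormedAddCommGroup X]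
    (Y : Ω → X) : Prop :=
  AEStronglyMeasurable Y P ∧ sigmaPow P σ p Y < ∞

/-- The generalized inverse distribution function (quantile function)
`F_g^{-1}(α) = inf {q : P(g ≤ q) ≥ α}`. -/
def quantileFn (P : Measure Ω) (g : Ω → ℝ) (α : ℝ) : ℝ :=
  sInf {q : ℝ | ENNReal.ofReal α ≤ P {ω | g ω ≤ q}}

variable {𝕂 : Type*} [RCLike 𝕂]

/-- The Köthe dual of `L_σ^p(P)`:
`{Z measurable : Z·Y ∈ L¹(P) for all Y ∈ L_σ^p(P)}`. -/
def KoetheDual (P : Measure Ω) (σ : ℝ → ℝ) (p : ℝ) (Z : Ω → 𝕂) : Prop :=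
  AEStronglyMeasurable Z P ∧
    ∀ Y : Ω → 𝕂, MemLsigma P σ p Y → Integrable (fun ω => Z ω * Y ω) P

/-- The average value-at-risk of level `α` of the (nonnegative) random variable `g`:
`AV@R_α(g) = (1/(1−α)) ∫_α^1 F_g^{-1}(u) du`. -/
def avar (P : Measure Ω) (g : Ω → ℝ) (α : ℝ) : ℝ≥0∞ :=
  ENNReal.ofReal (1 / (1 - α)) *
    ∫⁻ u in Set.Ioo α 1, ENNReal.ofReal (quantileFn P g u)

/-- `Z'` σ-dominates `Z`: there is a uniform `U` with
`AV@R_α(σ(U)·|Z'|) ≥ AV@R_α(|Z|)` for all `α < 1`. -/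
def SigmaDominates (P : Measure Ω) (σ : ℝ → ℝ) (Z' Z : Ω → 𝕂) : Prop :=
  ∃ U : Ω → ℝ, IsUniformRV P U ∧ ∀ α ∈ Set.Ico (0 : ℝ) 1,
    avar P (fun ω => ‖Z ω‖) α ≤ avar P (fun ω => σ (U ω) * ‖Z' ω‖) α

/-- `|Z|*_{σ,∞} = sup_{α ∈ [0,1)} AV@R_α(|Z|) / ((1/(1−α))·S_σ(α))
 = sup_{α ∈ [0,1)} (∫_α^1 F_{|Z|}^{-1}(u) du) / (∫_α^1 σ(u) du)`. -/
def dualNormInf (P : Measure Ω) (σ : ℝ → ℝ) (Z : Ω → 𝕂) : ℝ≥0∞ :=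
  ⨆ (α : ℝ) (_ : α ∈ Set.Ico (0 : ℝ) 1),
    (∫⁻ u in Set.Ioo α 1, ENNReal.ofReal (quantileFn P (fun ω => ‖Z ω‖) u)) /
      ENNReal.ofReal (∫ u in Set.Ioo α 1, σ u)

/-- `|Z|*_{σ,q} = inf {‖Z'‖_{σ,q} : Z' σ-dominates Z}` (with `inf ∅ = ∞`). -/
def dualNormQ (P : Measure Ω) (σ : ℝ → ℝ) (q : ℝ) (Z : Ω → 𝕂) : ℝ≥0∞ :=
  ⨅ (Z' : Ω → 𝕂) (_ : AEStronglyMeasurable Z' P ∧ SigmaDominates P σ Z' Z),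
    sigmaNorm P σ q Z'

section Auxiliary

open Set Filter Topology
open scoped ComplexConjugate

/-! ### Uniform random variables -/

lemma IsUniformRV.map_eq {P : Measure Ω} [IsProbabilityMeasure P] {U : Ω → ℝ}
    (hU : IsUniformRV P U) : P.map U = volume.restrict (Ioo (0 : ℝ) 1) := by
  obtain ⟨hm, h01, hcdf⟩ := hU
  have : IsProbabilityMeasure (P.map U) := Measure.isProbabilityMeasure_map hm.aemeasurable
  rw [← Measure.restrict_congr_set (Ioo_ae_eq_Icc (μ := volume) (a := (0 : ℝ)) (b := 1)).symm]
  refine Measure.ext_of_Iic _ _ fun a => ?_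
  rw [Measure.map_apply hm measurableSet_Iic, Measure.restrict_apply measurableSet_Iic]
  rcases lt_or_ge a 0 with ha | ha
  · have h1 : U ⁻¹' Iic a = ∅ := by
      ext ω; simpa using ha.trans_le (h01 ω).1
    have h2 : Iic a ∩ Icc (0 : ℝ) 1 = ∅ := by
      ext x; simp only [mem_inter_iff, mem_Iic, mem_Icc, mem_empty_iff_false]; grind
    rw [h1, h2]; simp
  rcases le_or_gt a 1 with ha1 | ha1
  · have h2 : Iic a ∩ Icc (0 : ℝ) 1 = Icc 0 a := by
      ext x; simp only [mem_inter_iff, mem_Iic, mem_Icc]; grind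
    rw [h2, Real.volume_Icc, sub_zero, ← hcdf a ⟨ha, ha1⟩]; rfl
  · have h1 : U ⁻¹' Iic a = univ := by
      ext ω; simpa using (h01 ω).2.trans ha1.le
    have h2 : Iic a ∩ Icc (0 : ℝ) 1 = Icc 0 1 := by
      ext x; simp only [mem_inter_iff, mem_Iic, mem_Icc]; grind
    rw [h1, h2]; simp

lemma IsUniformRV.ae_mem_Ioo {P : Measure Ω} [IsProbabilityMeasure P] {U : Ω → ℝ}
    (hU : IsUniformRV P U) : ∀ᵐ ω ∂P, U ω ∈ Ioo (0 : ℝ) 1 := by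
  refine ae_of_ae_map hU.1.aemeasurable ?_
  rw [hU.map_eq]
  exact ae_restrict_mem measurableSet_Ioo

lemma IsUniformRV.aemeasurable_comp {P : Measure Ω} [IsProbabilityMeasure P] {U : Ω → ℝ}
    (hU : IsUniformRV P U) {β : Type*} [MeasurableSpace β] {f : ℝ → β}
    (hf : AEMeasurable f (volume.restrict (Ioo (0 : ℝ) 1))) :
    AEMeasurable (fun ω => f (U ω)) P := by
  rw [← hU.map_eq] at hf
  exact hf.comp_measurable hU.1

lemma IsUniformRV.lintegral_comp {P : Measure Ω} [IsProbabilityMeasure P] {U : Ω → ℝ}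
    (hU : IsUniformRV P U) {f : ℝ → ℝ≥0∞}
    (hf : AEMeasurable f (volume.restrict (Ioo (0 : ℝ) 1))) :
    ∫⁻ ω, f (U ω) ∂P = ∫⁻ u in Ioo (0 : ℝ) 1, f u := by
  rw [← hU.map_eq] at hf ⊢
  rw [lintegral_map' hf hU.1.aemeasurable]

lemma IsUniformRV.setLIntegral_comp {P : Measure Ω} [IsProbabilityMeasure P] {U : Ω → ℝ}
    (hU : IsUniformRV P U) {f : ℝ → ℝ≥0∞}
    (hf : AEMeasurable f (volume.restrict (Ioo (0 : ℝ) 1))) {α : ℝ} (hα : 0 ≤ α) :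
    ∫⁻ ω in {ω | α < U ω}, f (U ω) ∂P = ∫⁻ u in Ioo α 1, f u := by
  have hs : MeasurableSet {ω | α < U ω} := measurableSet_lt measurable_const hU.1
  have h1 : ∫⁻ ω in {ω | α < U ω}, f (U ω) ∂P = ∫⁻ ω, (Ioi α).indicator f (U ω) ∂P := by
    rw [← lintegral_indicator hs]; rfl
  rw [h1, hU.lintegral_comp (hf.indicator measurableSet_Ioi),
    lintegral_indicator measurableSet_Ioi, Measure.restrict_restrict measurableSet_Ioi]
  congr 2
  ext x; simp only [mem_inter_iff, mem_Ioi, mem_Ioo]; grind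

lemma IsUniformRV.measure_lt {P : Measure Ω} [IsProbabilityMeasure P] {U : Ω → ℝ}
    (hU : IsUniformRV P U) {α : ℝ} (hα : 0 ≤ α) :
    P {ω | α < U ω} = ENNReal.ofReal (1 - α) := by
  have := hU.setLIntegral_comp (f := fun _ => 1) aemeasurable_const hα
  simpa using this

lemma IsUniformRV.measure_eq {P : Measure Ω} [IsProbabilityMeasure P] {U : Ω → ℝ}
    (hU : IsUniformRV P U) (a : ℝ) : P {ω | U ω = a} = 0 := by
  have h : P {ω | U ω = a} = (P.map U) {a} := by
    rw [Measure.map_apply hU.1 (measurableSet_singleton a)]; rfl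
  rw [h, hU.map_eq]
  simp

/-! ### Ranks in a continuous chain -/

/-- In a measurable total order without heavy ties, almost every point of a measurable set `A`
has a non-null part of `A` below it. -/
lemma measure_inter_initial_eq_zero {P : Measure Ω} [IsProbabilityMeasure P]
    {r : Ω → Ω → Prop} (hr : MeasurableSet {x : Ω × Ω | r x.1 x.2})
    (htot : ∀ a b, r a b ∨ r b a) {A : Set Ω} (hA : MeasurableSet A) :
    P {ω | ω ∈ A ∧ P {ω' | ω' ∈ A ∧ r ω' ω} = 0} = 0 := by
  set S : Set (Ω × Ω) := {x | x.1 ∈ A ∧ x.2 ∈ A ∧ r x.2 x.1} with hS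
  have hSm : MeasurableSet S :=
    (measurable_fst hA).inter ((measurable_snd hA).inter (measurable_swap hr))
  set B : Set Ω := {ω | ω ∈ A ∧ P {ω' | ω' ∈ A ∧ r ω' ω} = 0} with hB
  have hBm : MeasurableSet B := by
    have h1 : Measurable fun ω => P (Prod.mk ω ⁻¹' S) := measurable_measure_prodMk_left hSm
    have h2 : B = A ∩ (fun ω => P (Prod.mk ω ⁻¹' S)) ⁻¹' {0} := by
      ext ω
      simp only [hB, hS, mem_ofPred_eq, mem_inter_iff, mem_preimage, mem_singleton_iff,
        preimage_ofPred_eq]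
      refine and_congr_right fun h => ?_
      simp [h]
    rw [h2]
    exact hA.inter (h1 (measurableSet_singleton 0))
  have hBA : B ⊆ A := fun _ h => h.1
  set T : Set (Ω × Ω) := {x | x.1 ∈ B ∧ x.2 ∈ B ∧ r x.2 x.1} with hT
  have hTm : MeasurableSet T :=
    (measurable_fst hBm).inter ((measurable_snd hBm).inter (measurable_swap hr))
  have hT0 : (P.prod P) T = 0 := by
    rw [Measure.measure_prod_null hTm]
    refine Eventually.of_forall fun ω => ?_
    by_cases h : ω ∈ B
    · refine measure_mono_null ?_ h.2
      rintro ω' ⟨-, h2, h3⟩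
      exact ⟨h2.1, h3⟩
    · have : Prod.mk ω ⁻¹' T = ∅ := by
        ext ω'; simp [hT, h]
      simp [this]
  have hsub : B ×ˢ B ⊆ T ∪ Prod.swap ⁻¹' T := by
    rintro ⟨a, b⟩ ⟨ha, hb⟩
    rcases htot a b with h | h
    · exact Or.inr ⟨hb, ha, h⟩
    · exact Or.inl ⟨ha, hb, h⟩
  have hT1 : (P.prod P) (Prod.swap ⁻¹' T) = 0 := by
    rw [← Measure.map_apply measurable_swap hTm, Measure.prod_swap, hT0]
  have := measure_mono_null hsub (measure_union_null hT0 hT1)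
  rw [Measure.prod_prod] at this
  simpa using this

lemma measure_rank_le {P : Measure Ω} [IsProbabilityMeasure P]
    {r : Ω → Ω → Prop} (hr : MeasurableSet {x : Ω × Ω | r x.1 x.2})
    (htot : ∀ a b, r a b ∨ r b a) (htrans : ∀ a b c, r a b → r b c → r a c) (u : ℝ≥0∞) :
    P {ω | P {ω' | r ω' ω} ≤ u} ≤ u := by
  have hrank : Measurable fun ω => P {ω' | r ω' ω} :=
    measurable_measure_prodMk_right hr
  set A : Set Ω := {ω | P {ω' | r ω' ω} ≤ u} with hA
  have hAm : MeasurableSet A := measurableSet_le hrank measurable_const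
  have hsec : ∀ ω, MeasurableSet {ω' | r ω' ω} := fun ω => measurable_prodMk_right hr
  have hdown : ∀ a b, r a b → b ∈ A → a ∈ A := fun a b hab hb =>
    (measure_mono fun c hc => htrans c a b hc hab).trans hb
  rcases A.eq_empty_or_nonempty with hE | hne
  · rw [hE]; simp
  have : Nonempty A := hne.to_subtype
  obtain ⟨f, -, hf, hfm⟩ := exists_seq_tendsto_sInf
    (S := range fun ω : A => P (A \ {ω' | r ω' ω})) (range_nonempty _) (OrderBot.bddBelow _)
  choose g hg using hfm
  set i := sInf (range fun ω : A => P (A \ {ω' | r ω' ω}))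
  have hi : ∀ ω ∈ A, i ≤ P (A \ {ω' | r ω' ω}) := fun ω h => sInf_le ⟨⟨ω, h⟩, rfl⟩
  set B : Set Ω := A \ ⋃ n, {ω' | r ω' (g n)} with hB
  have hBm : MeasurableSet B := hAm.diff (MeasurableSet.iUnion fun n => hsec _)
  have hBi : P B ≤ i := by
    refine ge_of_tendsto' hf fun n => ?_
    rw [← hg n]
    exact measure_mono (sdiff_subset_sdiff_right (subset_iUnion (fun n => {ω' | r ω' (g n)}) n))
  have hB0 : P B = 0 := by
    rw [← measure_inter_initial_eq_zero (P := P) hr htot hBm]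
    congr 1
    ext ω
    refine ⟨fun h => ⟨h, ?_⟩, fun h => h.1⟩
    have hsub : A \ {ω' | r ω' ω} ⊆ B := by
      rintro ω' ⟨h1, h2⟩
      refine ⟨h1, fun h3 => ?_⟩
      obtain ⟨n, hn⟩ := mem_iUnion.1 h3
      refine h.2 (mem_iUnion.2 ⟨n, htrans _ _ _ ((htot ω ω').resolve_right h2) hn⟩)
    have h1 : P (B \ {ω' | r ω' ω}) = P B := by
      refine le_antisymm (measure_mono sdiff_subset) (hBi.trans ((hi ω h.1).trans ?_))
      exact measure_mono fun ω' h' => ⟨hsub h', h'.2⟩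
    have h2 := measure_inter_add_sdiff (μ := P) B (hsec ω)
    rw [h1] at h2
    exact (ENNReal.add_left_inj (measure_ne_top P B)).1 (h2.trans (zero_add _).symm)
  have hdir : Directed (· ⊆ ·) fun n => {ω' | r ω' (g n)} := by
    intro m n
    rcases htot (g m) (g n) with h | h
    · exact ⟨n, fun c hc => htrans _ _ _ hc h, subset_rfl⟩
    · exact ⟨m, subset_rfl, fun c hc => htrans _ _ _ hc h⟩
  have hcov : A ⊆ B ∪ ⋃ n, {ω' | r ω' (g n)} := by
    rw [hB, sdiff_union_self]; exact subset_union_left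
  calc P A ≤ P B + P (⋃ n, {ω' | r ω' (g n)}) := (measure_mono hcov).trans (measure_union_le _ _)
    _ = ⨆ n, P {ω' | r ω' (g n)} := by rw [hB0, zero_add, hdir.measure_iUnion]
    _ ≤ u := iSup_le fun n => (g n).2

/-! ### Quantile functions and comonotone uniform variables -/

lemma quantileFn_set_nonempty {P : Measure Ω} [IsProbabilityMeasure P] (g : Ω → ℝ)
    {u : ℝ} (hu : u < 1) : {q : ℝ | ENNReal.ofReal u ≤ P {ω | g ω ≤ q}}.Nonempty := by
  have hmono : Monotone fun n : ℕ => {ω | g ω ≤ n} := fun m n h ω (hω : g ω ≤ m) =>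
    show g ω ≤ n from hω.trans (Nat.cast_le.2 h)
  have hU : ⋃ n : ℕ, {ω | g ω ≤ n} = univ := by
    ext ω; simpa using exists_nat_ge (g ω)
  have ht := tendsto_measure_iUnion_atTop (μ := P) hmono
  rw [hU, measure_univ] at ht
  have hu' : ENNReal.ofReal u < 1 := by
    simpa using hu
  obtain ⟨n, hn⟩ := (ht.eventually (lt_mem_nhds hu')).exists
  exact ⟨n, hn.le⟩

lemma quantileFn_set_subset {P : Measure Ω} {g : Ω → ℝ} (hg : ∀ᵐ ω ∂P, 0 ≤ g ω)
    {u : ℝ} (hu : 0 < u) : {q : ℝ | ENNReal.ofReal u ≤ P {ω | g ω ≤ q}} ⊆ Ici 0 := by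
  intro q hq
  by_contra h
  have h0 : P {ω | g ω ≤ q} = 0 := by
    refine measure_mono_null (fun ω hω => ?_) hg
    exact not_le.2 (lt_of_le_of_lt hω (lt_of_not_ge (show ¬ (0 : ℝ) ≤ q from h)))
  rw [mem_ofPred_eq, h0] at hq
  exact absurd hq (by simpa using hu)

lemma quantileFn_monotoneOn {P : Measure Ω} [IsProbabilityMeasure P] {g : Ω → ℝ}
    (hg : ∀ᵐ ω ∂P, 0 ≤ g ω) : MonotoneOn (quantileFn P g) (Ioo (0 : ℝ) 1) := by
  intro u hu v hv huv
  refine csInf_le_csInf ⟨0, quantileFn_set_subset hg hu.1⟩ (quantileFn_set_nonempty g hv.2) ?_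
  exact fun q hq => (ENNReal.ofReal_le_ofReal huv).trans hq

lemma quantileFn_congr {P : Measure Ω} {g g' : Ω → ℝ} (h : g =ᵐ[P] g') :
    quantileFn P g = quantileFn P g' := by
  funext u
  unfold quantileFn
  congr 1
  ext q
  have : P {ω | g ω ≤ q} = P {ω | g' ω ≤ q} := by
    refine measure_congr ?_
    filter_upwards [h] with ω hω
    exact congrArg (· ≤ q) hω
  simp [this]

/-- On a space carrying a uniform variable, each nonnegative variable is the image of a uniform
variable under its own quantile function. -/
lemma exists_uniform_quantileFn {P : Measure Ω} [IsProbabilityMeasure P]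
    (hrich : ∃ U : Ω → ℝ, IsUniformRV P U) {g : Ω → ℝ} (hgm : AEMeasurable g P)
    (hg : ∀ᵐ ω ∂P, 0 ≤ g ω) :
    ∃ V : Ω → ℝ, IsUniformRV P V ∧ ∀ᵐ ω ∂P, g ω = quantileFn P g (V ω) := by
  wlog hm : Measurable g generalizing g
  · have hae := hgm.ae_eq_mk
    obtain ⟨V, hV, h⟩ := this hgm.measurable_mk.aemeasurable
      (by filter_upwards [hg, hae] with ω h1 h2; rwa [← h2]) hgm.measurable_mk
    refine ⟨V, hV, ?_⟩
    rw [quantileFn_congr hae]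
    filter_upwards [h, hae] with ω h1 h2
    rw [h2, ← h1]
  obtain ⟨U, hU⟩ := hrich
  set r : Ω → Ω → Prop := fun a b => g a < g b ∨ (g a = g b ∧ U a ≤ U b) with hrdef
  have hg1 : Measurable fun x : Ω × Ω => g x.1 := hm.comp measurable_fst
  have hg2 : Measurable fun x : Ω × Ω => g x.2 := hm.comp measurable_snd
  have hu1 : Measurable fun x : Ω × Ω => U x.1 := hU.1.comp measurable_fst
  have hu2 : Measurable fun x : Ω × Ω => U x.2 := hU.1.comp measurable_snd
  have hr : MeasurableSet {x : Ω × Ω | r x.1 x.2} :=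
    (measurableSet_lt hg1 hg2).union ((measurableSet_eq_fun hg1 hg2).inter
      (measurableSet_le hu1 hu2))
  have htot : ∀ a b, r a b ∨ r b a := by
    intro a b; simp only [hrdef]; grind
  have htrans : ∀ a b c, r a b → r b c → r a c := by
    intro a b c; simp only [hrdef]; grind
  have hsec : ∀ ω, MeasurableSet {ω' | r ω' ω} := fun ω => measurable_prodMk_right hr
  have hrank : Measurable fun ω => P {ω' | r ω' ω} := measurable_measure_prodMk_right hr
  set V : Ω → ℝ := fun ω => (P {ω' | r ω' ω}).toReal with hVdef
  have hV1 : ∀ ω, P {ω' | r ω' ω} = ENNReal.ofReal (V ω) := fun ω =>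
    (ENNReal.ofReal_toReal (measure_ne_top _ _)).symm
  have hVm : Measurable V := hrank.ennreal_toReal
  have hV01 : ∀ ω, V ω ∈ Icc (0 : ℝ) 1 := fun ω =>
    ⟨ENNReal.toReal_nonneg, ENNReal.toReal_mono ENNReal.one_ne_top prob_le_one⟩
  have hup : ∀ ω, P {ω' | r ω ω'} = ENNReal.ofReal (1 - V ω) := by
    intro ω
    have hc : P {ω' | r ω' ω}ᶜ = ENNReal.ofReal (1 - V ω) := by
      rw [prob_compl_eq_one_sub (hsec ω), hV1, ENNReal.ofReal_sub _ (hV01 ω).1,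
        ENNReal.ofReal_one]
    rw [← hc]
    refine le_antisymm ?_ (measure_mono fun ω' h => (htot ω ω').resolve_right h)
    have hsub : {ω' | r ω ω'} ⊆ {ω' | r ω' ω}ᶜ ∪ {ω' | U ω' = U ω} := by
      intro ω' h
      by_cases h2 : r ω' ω
      · refine Or.inr ?_
        simp only [hrdef, mem_ofPred_eq] at h h2 ⊢
        grind
      · exact Or.inl h2
    refine (measure_mono hsub).trans ((measure_union_le _ _).trans ?_)
    rw [hU.measure_eq, add_zero]
  have hVU : IsUniformRV P V := by
    refine ⟨hVm, hV01, fun u hu => le_antisymm ?_ ?_⟩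
    · have := measure_rank_le (P := P) hr htot htrans (ENNReal.ofReal u)
      refine le_trans (measure_mono fun ω hω => ?_) this
      rw [mem_ofPred_eq, hV1]
      exact ENNReal.ofReal_le_ofReal hω
    · have := measure_rank_le (P := P) (r := fun a b => r b a) (measurable_swap hr)
        (fun a b => htot b a) (fun a b c h1 h2 => htrans _ _ _ h2 h1) (ENNReal.ofReal (1 - u))
      have hsm : MeasurableSet {ω | V ω ≤ u} := measurableSet_le hVm measurable_const
      have h1 : P {ω | V ω ≤ u}ᶜ ≤ ENNReal.ofReal (1 - u) := by
        refine le_trans (measure_mono fun ω hω => ?_) this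
        rw [mem_ofPred_eq, hup]
        have : u < V ω := not_le.1 hω
        exact ENNReal.ofReal_le_ofReal (by linarith)
      rw [prob_compl_eq_one_sub hsm, ENNReal.ofReal_sub _ hu.1, ENNReal.ofReal_one] at h1
      have h2 : ENNReal.ofReal u ≤ 1 := by simpa using hu.2
      exact (ENNReal.sub_le_sub_iff_left h2 ENNReal.one_ne_top).1 h1
  refine ⟨V, hVU, ?_⟩
  have hbad : ∀ q : ℚ, ∀ᵐ ω ∂P,
      ¬ (ω ∈ {ω | (q : ℝ) < g ω} ∧ P {ω' | ω' ∈ {ω | (q : ℝ) < g ω} ∧ r ω' ω} = 0) := fun q => by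
    have := measure_inter_initial_eq_zero (P := P) hr htot
      (A := {ω | (q : ℝ) < g ω}) (measurableSet_lt measurable_const hm)
    rw [ae_iff]
    simpa using this
  filter_upwards [ae_all_iff.2 hbad, hVU.ae_mem_Ioo] with ω hω hVω
  have hne := quantileFn_set_nonempty (P := P) g hVω.2
  have hbd : BddBelow {q : ℝ | ENNReal.ofReal (V ω) ≤ P {ω | g ω ≤ q}} :=
    ⟨0, quantileFn_set_subset hg hVω.1⟩
  refine le_antisymm (le_csInf hne fun q hq => ?_) (csInf_le hbd ?_)
  · by_contra! hlt
    obtain ⟨s, hs1, hs2⟩ := exists_rat_btwn hlt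
    refine hω s ⟨hs2, ?_⟩
    have hq' : P {ω' | r ω' ω} ≤ P {ω | g ω ≤ q} := (hV1 ω).trans_le hq
    have hsub : {ω | g ω ≤ q} ⊆ {ω' | r ω' ω} := fun a ha => Or.inl (lt_of_le_of_lt ha hlt)
    have h0 : P ({ω' | r ω' ω} \ {ω | g ω ≤ q}) = 0 := by
      rw [measure_sdiff hsub (measurableSet_le hm measurable_const).nullMeasurableSet
        (measure_ne_top _ _)]
      exact tsub_eq_zero_of_le hq'
    refine measure_mono_null (t := {ω' | r ω' ω} \ {ω | g ω ≤ q}) ?_ h0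
    rintro a ⟨ha1, ha2⟩
    exact ⟨ha2, not_le.2 (hs1.trans ha1)⟩
  · rw [mem_ofPred_eq, ← hV1]
    refine measure_mono fun a ha => ?_
    rcases ha with h | h
    · exact h.le
    · exact h.1.le

/-! ### Stochastic domination and the Hardy–Littlewood inequality -/

lemma volume_ofReal_lt (c : ℝ≥0∞) :
    volume.restrict (Ioi (0 : ℝ)) {t | ENNReal.ofReal t < c} = c := by
  have hm : MeasurableSet {t : ℝ | ENNReal.ofReal t < c} :=
    measurableSet_lt ENNReal.measurable_ofReal measurable_const
  rw [Measure.restrict_apply hm]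
  induction c with
  | top =>
    have : {t : ℝ | ENNReal.ofReal t < ⊤} ∩ Ioi 0 = Ioi 0 := by
      ext t; simp
    rw [this, Real.volume_Ioi]
  | coe c =>
    have : {t : ℝ | ENNReal.ofReal t < c} ∩ Ioi 0 = Ioo 0 (c : ℝ) := by
      ext t
      simp only [mem_inter_iff, mem_ofPred_eq, mem_Ioi, mem_Ioo]
      refine ⟨fun h => ⟨h.2, ?_⟩, fun h => ⟨?_, h.1⟩⟩
      · have := h.1
        rwa [← ENNReal.ofReal_coe_nnreal, ENNReal.ofReal_lt_ofReal_iff_of_nonneg h.2.le] at this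
      · rw [← ENNReal.ofReal_coe_nnreal, ENNReal.ofReal_lt_ofReal_iff_of_nonneg h.1.le]
        exact h.2
    rw [this, Real.volume_Ioo, sub_zero, ENNReal.ofReal_coe_nnreal]

lemma lintegral_eq_lintegral_meas_ofReal_lt {β : Type*} [MeasurableSpace β] (ν : Measure β)
    [SFinite ν] {F : β → ℝ≥0∞} (hF : Measurable F) :
    ∫⁻ x, F x ∂ν = ∫⁻ t in Ioi (0 : ℝ), ν {x | ENNReal.ofReal t < F x} := by
  set S : Set (β × ℝ) := {z | ENNReal.ofReal z.2 < F z.1} with hS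
  have hSm : MeasurableSet S :=
    measurableSet_lt (ENNReal.measurable_ofReal.comp measurable_snd) (hF.comp measurable_fst)
  have h1 := Measure.prod_apply (μ := ν) (ν := volume.restrict (Ioi (0 : ℝ))) hSm
  have h2 := Measure.prod_apply_symm (μ := ν) (ν := volume.restrict (Ioi (0 : ℝ))) hSm
  rw [h1] at h2
  calc ∫⁻ x, F x ∂ν = ∫⁻ x, volume.restrict (Ioi (0 : ℝ)) (Prod.mk x ⁻¹' S) ∂ν :=
        lintegral_congr fun x => (volume_ofReal_lt (F x)).symm
    _ = _ := h2

lemma Monotone.lintegral_le_of_measure_Ioi_le {ν₁ ν₂ : Measure ℝ} [SFinite ν₁] [SFinite ν₂]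
    [NullSingletonClass ν₁] (h : ∀ a, ν₁ (Ioi a) ≤ ν₂ (Ioi a)) (huniv : ν₁ univ ≤ ν₂ univ)
    {F : ℝ → ℝ≥0∞} (hF : Monotone F) : ∫⁻ x, F x ∂ν₁ ≤ ∫⁻ x, F x ∂ν₂ := by
  rw [lintegral_eq_lintegral_meas_ofReal_lt ν₁ hF.measurable,
    lintegral_eq_lintegral_meas_ofReal_lt ν₂ hF.measurable]
  refine lintegral_mono fun t => ?_
  set S : Set ℝ := {x | ENNReal.ofReal t < F x} with hS
  have hup : ∀ x ∈ S, ∀ y, x ≤ y → y ∈ S := fun x hx y hxy => lt_of_lt_of_le hx (hF hxy)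
  rcases S.eq_empty_or_nonempty with hE | hne
  · rw [hE]; simp
  by_cases hb : BddBelow S
  · have h1 : S ⊆ Ici (sInf S) := fun x hx => csInf_le hb hx
    have h2 : Ioi (sInf S) ⊆ S := fun x hx => by
      obtain ⟨y, hy, hyx⟩ := exists_lt_of_csInf_lt hne hx
      exact hup y hy x hyx.le
    calc ν₁ S ≤ ν₁ (Ici (sInf S)) := measure_mono h1
      _ = ν₁ (Ioi (sInf S)) := measure_congr Ioi_ae_eq_Ici.symm
      _ ≤ ν₂ (Ioi (sInf S)) := h _
      _ ≤ ν₂ S := measure_mono h2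
  · have : S = univ := by
      refine eq_univ_of_forall fun x => ?_
      rw [not_bddBelow_iff] at hb
      obtain ⟨y, hy, hyx⟩ := hb x
      exact hup y hy x hyx.le
    rw [this]; exact huniv

/-- The monotone extension to `ℝ` of a function on `(0,1)`. -/
lemma MonotoneOn.exists_monotone_Ioo {f : ℝ → ℝ≥0∞} (hf : MonotoneOn f (Ioo (0 : ℝ) 1)) :
    ∃ F : ℝ → ℝ≥0∞, Monotone F ∧ EqOn f F (Ioo 0 1) := by
  refine ⟨fun u => if u ≤ 0 then 0 else if u < 1 then f u else ⊤, fun u v huv => ?_, ?_⟩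
  · dsimp only
    split_ifs with h1 h2 h3 h4 h5 h6 h7
    all_goals first | exact zero_le | exact le_top | (exfalso; linarith) | skip
    exact hf ⟨by linarith, by linarith⟩ ⟨by linarith, by linarith⟩ huv
  · intro u hu
    simp [not_le.2 hu.1, hu.2]

lemma MonotoneOn.aemeasurable_Ioo {f : ℝ → ℝ≥0∞} (hf : MonotoneOn f (Ioo (0 : ℝ) 1)) :
    AEMeasurable f (volume.restrict (Ioo (0 : ℝ) 1)) :=
  aemeasurable_restrict_of_monotoneOn measurableSet_Ioo hf

lemma lintegral_mul_comp_le_of_tail_le {P : Measure Ω} [IsProbabilityMeasure P]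
    {X₁ X₂ : Ω → ℝ≥0∞} (hX₁ : AEMeasurable X₁ P) (hX₂ : AEMeasurable X₂ P)
    {U₁ U₂ : Ω → ℝ} (hU₁ : IsUniformRV P U₁) (hU₂ : IsUniformRV P U₂)
    (h : ∀ α ∈ Ico (0 : ℝ) 1, ∫⁻ ω in {ω | α < U₁ ω}, X₁ ω ∂P ≤ ∫⁻ ω in {ω | α < U₂ ω}, X₂ ω ∂P)
    {f : ℝ → ℝ≥0∞} (hf : MonotoneOn f (Ioo (0 : ℝ) 1)) :
    ∫⁻ ω, X₁ ω * f (U₁ ω) ∂P ≤ ∫⁻ ω, X₂ ω * f (U₂ ω) ∂P := by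
  obtain ⟨F, hF, hfF⟩ := hf.exists_monotone_Ioo
  have key : ∀ (X : Ω → ℝ≥0∞) (U : Ω → ℝ), AEMeasurable X P → IsUniformRV P U →
      ∫⁻ ω, X ω * f (U ω) ∂P = ∫⁻ u, F u ∂((P.withDensity X).map U) := by
    intro X U hX hU
    rw [lintegral_map hF.measurable hU.1,
      lintegral_withDensity_eq_lintegral_mul₀ hX (g := fun ω => F (U ω)) (hF.measurable.comp hU.1).aemeasurable]
    refine lintegral_congr_ae ?_
    filter_upwards [hU.ae_mem_Ioo] with ω hω
    simp [hfF hω]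
  have htail : ∀ (X : Ω → ℝ≥0∞) (U : Ω → ℝ), IsUniformRV P U → ∀ a,
      (P.withDensity X).map U (Ioi a) = ∫⁻ ω in {ω | a < U ω}, X ω ∂P := by
    intro X U hU a
    rw [Measure.map_apply hU.1 measurableSet_Ioi, withDensity_apply _ (hU.1 measurableSet_Ioi)]
    rfl
  have hneg : ∀ (X : Ω → ℝ≥0∞) (U : Ω → ℝ), IsUniformRV P U → ∀ a < 0,
      ∫⁻ ω in {ω | a < U ω}, X ω ∂P = ∫⁻ ω, X ω ∂P := by
    intro X U hU a ha
    have : {ω | a < U ω} = univ := eq_univ_of_forall fun ω => ha.trans_le (hU.2.1 ω).1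
    rw [this, Measure.restrict_univ]
  have hzero : ∀ (X : Ω → ℝ≥0∞) (U : Ω → ℝ), IsUniformRV P U →
      ∫⁻ ω in {ω | 0 < U ω}, X ω ∂P = ∫⁻ ω, X ω ∂P := by
    intro X U hU
    rw [Measure.restrict_eq_self_of_ae_mem]
    filter_upwards [hU.ae_mem_Ioo] with ω hω using hω.1
  have hle : ∫⁻ ω, X₁ ω ∂P ≤ ∫⁻ ω, X₂ ω ∂P := by
    rw [← hzero X₁ U₁ hU₁, ← hzero X₂ U₂ hU₂]
    exact h 0 ⟨le_rfl, one_pos⟩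
  rw [key X₁ U₁ hX₁ hU₁, key X₂ U₂ hX₂ hU₂]
  have : NullSingletonClass ((P.withDensity X₁).map U₁) := ⟨fun a => by
    rw [Measure.map_apply hU₁.1 (measurableSet_singleton a)]
    exact withDensity_absolutelyContinuous _ _ (hU₁.measure_eq a)⟩
  refine Monotone.lintegral_le_of_measure_Ioi_le (fun a => ?_) ?_ hF
  · rw [htail X₁ U₁ hU₁, htail X₂ U₂ hU₂]
    rcases lt_or_ge a 0 with ha | ha
    · rw [hneg X₁ U₁ hU₁ a ha, hneg X₂ U₂ hU₂ a ha]
      exact hle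
    rcases lt_or_ge a 1 with ha1 | ha1
    · exact h a ⟨ha, ha1⟩
    · have : {ω | a < U₁ ω} = ∅ :=
        eq_empty_of_forall_notMem fun ω hω => absurd (hU₁.2.1 ω).2 (not_le.2 (ha1.trans_lt hω))
      rw [this]; simp
  · rw [Measure.map_apply hU₁.1 .univ, Measure.map_apply hU₂.1 .univ]
    simpa using hle

lemma setLIntegral_tail_le {P : Measure Ω} [IsProbabilityMeasure P] {X : Ω → ℝ≥0∞}
    {x : ℝ → ℝ≥0∞} (hx : MonotoneOn x (Ioo (0 : ℝ) 1)) {V : Ω → ℝ} (hV : IsUniformRV P V)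
    (hXV : ∀ᵐ ω ∂P, X ω = x (V ω)) {U : Ω → ℝ} (hU : IsUniformRV P U) {α : ℝ} (hα : 0 ≤ α) :
    ∫⁻ ω in {ω | α < U ω}, X ω ∂P ≤ ∫⁻ ω in {ω | α < V ω}, X ω ∂P := by
  have hA : MeasurableSet {ω | α < U ω} := measurableSet_lt measurable_const hU.1
  have hB : MeasurableSet {ω | α < V ω} := measurableSet_lt measurable_const hV.1
  set A := {ω | α < U ω}
  set B := {ω | α < V ω} with hBdef
  have hPAB : P A = P B := by rw [hU.measure_lt hα, hV.measure_lt hα]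
  rcases hα.eq_or_lt with h0 | hpos
  · have : P.restrict B = P := by
      rw [Measure.restrict_eq_self_of_ae_mem]
      filter_upwards [hV.ae_mem_Ioo] with ω hω
      rw [hBdef, ← h0]; exact hω.1
    rw [this]
    exact setLIntegral_le_lintegral _ _
  rcases le_or_gt 1 α with h1 | h1
  · have : A = ∅ :=
      eq_empty_of_forall_notMem fun ω hω => absurd (hU.2.1 ω).2 (not_le.2 (h1.trans_lt hω))
    rw [this]; simp
  have hdiff : P (A \ B) = P (B \ A) := by
    have h1 := measure_inter_add_sdiff (μ := P) A hB
    have h2 := measure_inter_add_sdiff (μ := P) B hA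
    rw [inter_comm, ← hPAB, ← h1, inter_comm] at h2
    exact ((ENNReal.add_right_inj (measure_ne_top _ _)).1 h2).symm
  calc ∫⁻ ω in A, X ω ∂P = ∫⁻ ω in A ∩ B, X ω ∂P + ∫⁻ ω in A \ B, X ω ∂P :=
        (lintegral_inter_add_sdiff _ _ hB).symm
    _ ≤ ∫⁻ ω in A ∩ B, X ω ∂P + ∫⁻ _ in A \ B, x α ∂P := by
        gcongr 1
        refine setLIntegral_mono_ae' (hA.diff hB) ?_
        filter_upwards [hXV, hV.ae_mem_Ioo] with ω h1 h2 h3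
        rw [h1]
        exact hx h2 ⟨hpos, by assumption⟩ (not_lt.1 h3.2)
    _ = ∫⁻ ω in B ∩ A, X ω ∂P + ∫⁻ _ in B \ A, x α ∂P := by
        rw [setLIntegral_const, setLIntegral_const, hdiff, inter_comm]
    _ ≤ ∫⁻ ω in B ∩ A, X ω ∂P + ∫⁻ ω in B \ A, X ω ∂P := by
        gcongr 1
        refine setLIntegral_mono_ae' (hB.diff hA) ?_
        filter_upwards [hXV, hV.ae_mem_Ioo] with ω h1 h2 h3
        rw [h1]
        exact hx ⟨hpos, by assumption⟩ h2 h3.1.le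
    _ = ∫⁻ ω in B, X ω ∂P := lintegral_inter_add_sdiff _ _ hA

/-- The Hardy–Littlewood rearrangement inequality. -/
lemma lintegral_mul_comp_le {P : Measure Ω} [IsProbabilityMeasure P] {X : Ω → ℝ≥0∞}
    {x : ℝ → ℝ≥0∞} (hx : MonotoneOn x (Ioo (0 : ℝ) 1)) {V : Ω → ℝ} (hV : IsUniformRV P V)
    (hXV : ∀ᵐ ω ∂P, X ω = x (V ω)) {U : Ω → ℝ} (hU : IsUniformRV P U)
    {f : ℝ → ℝ≥0∞} (hf : MonotoneOn f (Ioo (0 : ℝ) 1)) :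
    ∫⁻ ω, X ω * f (U ω) ∂P ≤ ∫⁻ u in Ioo (0 : ℝ) 1, x u * f u := by
  have hX : AEMeasurable X P := (hV.aemeasurable_comp hx.aemeasurable_Ioo).congr
    (by filter_upwards [hXV] with ω h using h.symm)
  refine (lintegral_mul_comp_le_of_tail_le hX hX hU hV
    (fun α hα => setLIntegral_tail_le hx hV hXV hU hα.1) hf).trans_eq ?_
  rw [← hV.lintegral_comp (f := fun u => x u * f u) (hx.aemeasurable_Ioo.mul hf.aemeasurable_Ioo)]
  refine lintegral_congr_ae ?_
  filter_upwards [hXV] with ω h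
  simp [h]

/-! ### Distortion functions -/

lemma IsDistortion.monotoneOn_ofReal {σ : ℝ → ℝ} (hσ : IsDistortion σ) :
    MonotoneOn (fun u => ENNReal.ofReal (σ u)) (Ioo (0 : ℝ) 1) := fun _ hu _ hv huv =>
  ENNReal.ofReal_le_ofReal (hσ.mono ⟨hu.1.le, hu.2⟩ ⟨hv.1.le, hv.2⟩ huv)

lemma IsDistortion.lintegral_eq_one {σ : ℝ → ℝ} (hσ : IsDistortion σ) :
    ∫⁻ u in Ioo (0 : ℝ) 1, ENNReal.ofReal (σ u) = 1 := by
  have hint : Integrable σ (volume.restrict (Ioo (0 : ℝ) 1)) := by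
    by_contra h
    have := hσ.integral_one
    rw [integral_undef h] at this
    exact zero_ne_one this
  rw [← ofReal_integral_eq_lintegral_ofReal hint, hσ.integral_one, ENNReal.ofReal_one]
  filter_upwards [ae_restrict_mem measurableSet_Ioo] with u hu
  exact hσ.nonneg u ⟨hu.1.le, hu.2⟩

lemma setLIntegral_Ioo_add {f : ℝ → ℝ≥0∞} {α : ℝ} (h0 : 0 ≤ α) (h1 : α < 1) :
    ∫⁻ u in Ioo (0 : ℝ) 1, f u = (∫⁻ u in Ioc (0 : ℝ) α, f u) + ∫⁻ u in Ioo α 1, f u := by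
  have hd : Disjoint (Ioc (0 : ℝ) α) (Ioo α 1) := by
    rw [Set.disjoint_left]; intro x hx hx'; exact absurd hx.2 (not_le.2 hx'.1)
  rw [← Ioc_union_Ioo_eq_Ioo h0 h1, lintegral_union measurableSet_Ioo hd]

lemma IsDistortion.ofReal_le_tail {σ : ℝ → ℝ} (hσ : IsDistortion σ) {α : ℝ}
    (h0 : 0 ≤ α) (h1 : α < 1) :
    ENNReal.ofReal (1 - α) ≤ ∫⁻ u in Ioo α 1, ENNReal.ofReal (σ u) := by
  have hsum := hσ.lintegral_eq_one
  rw [setLIntegral_Ioo_add h0 h1] at hsum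
  rcases le_or_gt 1 (σ α) with h | h
  · calc ENNReal.ofReal (1 - α) = ∫⁻ _ in Ioo α 1, 1 := by simp
      _ ≤ _ := by
        refine setLIntegral_mono' measurableSet_Ioo fun u hu => ?_
        rw [← ENNReal.ofReal_one]
        exact ENNReal.ofReal_le_ofReal
          (h.trans (hσ.mono ⟨h0, h1⟩ ⟨h0.trans hu.1.le, hu.2⟩ hu.1.le))
  · have hle : ∫⁻ u in Ioc (0 : ℝ) α, ENNReal.ofReal (σ u) ≤ ENNReal.ofReal α := by
      calc _ ≤ ∫⁻ _ in Ioc (0 : ℝ) α, 1 := by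
            refine setLIntegral_mono' measurableSet_Ioc fun u hu => ?_
            rw [← ENNReal.ofReal_one]
            exact ENNReal.ofReal_le_ofReal
              ((hσ.mono ⟨hu.1.le, hu.2.trans_lt h1⟩ ⟨h0, h1⟩ hu.2).trans h.le)
        _ = _ := by simp
    rw [ENNReal.ofReal_sub _ h0, ENNReal.ofReal_one, ← hsum]
    exact tsub_le_iff_left.2 (add_le_add_left hle _)

lemma IsUniformRV.lintegral_distortion {P : Measure Ω} [IsProbabilityMeasure P] {U : Ω → ℝ}
    (hU : IsUniformRV P U) {σ : ℝ → ℝ} (hσ : IsDistortion σ) :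
    ∫⁻ ω, ENNReal.ofReal (σ (U ω)) ∂P = 1 :=
  (hU.lintegral_comp hσ.monotoneOn_ofReal.aemeasurable_Ioo).trans hσ.lintegral_eq_one

/-! ### The rearrangement-invariant modular -/

/-- `sup_U E[σ(U) X^p]` for a nonnegative extended-valued variable `X`. -/
def rhoPow (P : Measure Ω) (σ : ℝ → ℝ) (p : ℝ) (X : Ω → ℝ≥0∞) : ℝ≥0∞ :=
  ⨆ (U : Ω → ℝ) (_ : IsUniformRV P U), ∫⁻ ω, ENNReal.ofReal (σ (U ω)) * X ω ^ p ∂P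

lemma sigmaPow_eq_rhoPow (P : Measure Ω) (σ : ℝ → ℝ) (p : ℝ) (Y : Ω → 𝕂) :
    sigmaPow P σ p Y = rhoPow P σ p fun ω => (‖Y ω‖₊ : ℝ≥0∞) := rfl

lemma le_rhoPow {P : Measure Ω} {σ : ℝ → ℝ} {p : ℝ} {X : Ω → ℝ≥0∞} {U : Ω → ℝ}
    (hU : IsUniformRV P U) :
    ∫⁻ ω, ENNReal.ofReal (σ (U ω)) * X ω ^ p ∂P ≤ rhoPow P σ p X :=
  le_iSup₂_of_le U hU le_rfl

lemma rhoPow_mono {P : Measure Ω} {σ : ℝ → ℝ} {p : ℝ} (hp : 0 ≤ p) {X Y : Ω → ℝ≥0∞}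
    (h : ∀ᵐ ω ∂P, X ω ≤ Y ω) : rhoPow P σ p X ≤ rhoPow P σ p Y := by
  refine iSup₂_mono fun U hU => lintegral_mono_ae ?_
  filter_upwards [h] with ω hω
  gcongr

lemma rhoPow_const_mul {P : Measure Ω} {σ : ℝ → ℝ} {p : ℝ} (hp : 0 ≤ p) {c : ℝ≥0∞} (hc : c ≠ ⊤)
    (X : Ω → ℝ≥0∞) : rhoPow P σ p (fun ω => c * X ω) = c ^ p * rhoPow P σ p X := by
  unfold rhoPow
  simp_rw [ENNReal.mul_iSup]
  congr! 4 with U hU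
  rw [← lintegral_const_mul' _ _ (ENNReal.rpow_ne_top_of_nonneg hp hc)]
  refine lintegral_congr fun ω => ?_
  rw [ENNReal.mul_rpow_of_nonneg _ _ hp]
  ring

lemma MonotoneOn.rpow_ennreal {y : ℝ → ℝ≥0∞} {s : Set ℝ} (hy : MonotoneOn y s) {p : ℝ}
    (hp : 0 ≤ p) : MonotoneOn (fun u => y u ^ p) s := fun _ hu _ hv huv =>
  ENNReal.rpow_le_rpow (hy hu hv huv) hp

lemma MonotoneOn.mul_ennreal {x y : ℝ → ℝ≥0∞} {s : Set ℝ} (hx : MonotoneOn x s)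
    (hy : MonotoneOn y s) : MonotoneOn (fun u => x u * y u) s := fun _ hu _ hv huv =>
  mul_le_mul' (hx hu hv huv) (hy hu hv huv)

lemma rhoPow_eq_lintegral {P : Measure Ω} [IsProbabilityMeasure P] {σ : ℝ → ℝ}
    (hσ : IsDistortion σ) {p : ℝ} (hp : 0 ≤ p) {X : Ω → ℝ≥0∞} {x : ℝ → ℝ≥0∞}
    (hx : MonotoneOn x (Ioo (0 : ℝ) 1)) {V : Ω → ℝ} (hV : IsUniformRV P V)
    (hXV : ∀ᵐ ω ∂P, X ω = x (V ω)) :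
    rhoPow P σ p X = ∫⁻ u in Ioo (0 : ℝ) 1, ENNReal.ofReal (σ u) * x u ^ p := by
  refine le_antisymm (iSup₂_le fun U hU => ?_) ?_
  · have := lintegral_mul_comp_le (X := fun ω => X ω ^ p) (hx.rpow_ennreal hp) hV
      (by filter_upwards [hXV] with ω h; rw [h]) hU hσ.monotoneOn_ofReal
    simpa [mul_comm] using this
  · rw [← hV.lintegral_comp (hσ.monotoneOn_ofReal.mul_ennreal (hx.rpow_ennreal hp)).aemeasurable_Ioo]
    refine le_trans (le_of_eq (lintegral_congr_ae ?_)) (le_rhoPow hV)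
    filter_upwards [hXV] with ω h
    rw [h]

/-- Every nonnegative finite variable is a nondecreasing function of a uniform variable. -/
lemma exists_comonotone {P : Measure Ω} [IsProbabilityMeasure P]
    (hrich : ∃ U : Ω → ℝ, IsUniformRV P U) {X : Ω → ℝ≥0} (hX : AEMeasurable X P) :
    ∃ (V : Ω → ℝ) (x : ℝ → ℝ≥0), IsUniformRV P V ∧
      MonotoneOn (fun u => (x u : ℝ≥0∞)) (Ioo (0 : ℝ) 1) ∧
      (∀ u, (x u : ℝ≥0∞) = ENNReal.ofReal (quantileFn P (fun ω => (X ω : ℝ)) u)) ∧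
      ∀ᵐ ω ∂P, X ω = x (V ω) := by
  have h0 : ∀ᵐ ω ∂P, 0 ≤ ((X ω : ℝ≥0) : ℝ) := Eventually.of_forall fun ω => NNReal.coe_nonneg _
  obtain ⟨V, hV, h⟩ := exists_uniform_quantileFn hrich hX.coe_nnreal_real h0
  refine ⟨V, fun u => (quantileFn P (fun ω => (X ω : ℝ)) u).toNNReal, hV, ?_, fun u => rfl, ?_⟩
  · intro u hu v hv huv
    exact ENNReal.coe_le_coe.2 (Real.toNNReal_le_toNNReal (quantileFn_monotoneOn h0 hu hv huv))
  · filter_upwards [h] with ω hω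
    rw [← hω, Real.toNNReal_coe]

lemma lintegral_rpow_le_rhoPow {P : Measure Ω} [IsProbabilityMeasure P]
    (hrich : ∃ U : Ω → ℝ, IsUniformRV P U) {σ : ℝ → ℝ} (hσ : IsDistortion σ) {p : ℝ} (hp : 0 ≤ p)
    {X : Ω → ℝ≥0} (hX : AEMeasurable X P) :
    ∫⁻ ω, (X ω : ℝ≥0∞) ^ p ∂P ≤ rhoPow P σ p fun ω => X ω := by
  obtain ⟨V, x, hV, hx, -, hXV⟩ := exists_comonotone hrich hX
  have hσm := hσ.monotoneOn_ofReal.aemeasurable_Ioo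
  have := lintegral_mul_comp_le_of_tail_le (P := P) (X₁ := fun _ => 1)
    (X₂ := fun ω => ENNReal.ofReal (σ (V ω))) aemeasurable_const (hV.aemeasurable_comp hσm) hV hV
    (fun α hα => by
      rw [hV.setLIntegral_comp hσm hα.1, setLIntegral_one, hV.measure_lt hα.1]
      exact hσ.ofReal_le_tail hα.1 hα.2) (hx.rpow_ennreal hp)
  refine le_trans ?_ (this.trans ?_)
  · refine le_of_eq (lintegral_congr_ae ?_)
    filter_upwards [hXV] with ω h
    simp [h]
  · refine le_trans (le_of_eq (lintegral_congr_ae ?_)) (le_rhoPow hV)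
    filter_upwards [hXV] with ω h
    simp [h]

lemma rhoPow_const {P : Measure Ω} [IsProbabilityMeasure P]
    (hrich : ∃ U : Ω → ℝ, IsUniformRV P U) {σ : ℝ → ℝ} (hσ : IsDistortion σ) {p : ℝ} (hp : 0 ≤ p)
    {c : ℝ≥0∞} (hc : c ≠ ⊤) : rhoPow P σ p (fun _ => c) = c ^ p := by
  obtain ⟨U, hU⟩ := hrich
  have h1 : rhoPow P σ p (fun _ => 1) = 1 := by
    refine le_antisymm (iSup₂_le fun V hV => ?_) ?_
    · simp [hV.lintegral_distortion hσ]
    · refine le_trans (le_of_eq ?_) (le_rhoPow hU)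
      simp [hU.lintegral_distortion hσ]
  have := rhoPow_const_mul (P := P) (σ := σ) hp hc (fun _ => 1)
  simpa [h1] using this

/-- Uniform absolute continuity of the modular. -/
lemma tendsto_rhoPow_zero {P : Measure Ω} [IsProbabilityMeasure P]
    (hrich : ∃ U : Ω → ℝ, IsUniformRV P U) {σ : ℝ → ℝ} (hσ : IsDistortion σ) {p : ℝ} (hp : 0 < p)
    {X : Ω → ℝ≥0} (hX : AEMeasurable X P) (hfin : rhoPow P σ p (fun ω => X ω) ≠ ⊤)
    {Xs : ℕ → Ω → ℝ≥0∞} (hXs : ∀ n, AEMeasurable (Xs n) P)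
    (hle : ∀ n, ∀ᵐ ω ∂P, Xs n ω ≤ X ω)
    (hlim : ∀ᵐ ω ∂P, Tendsto (fun n => Xs n ω) atTop (𝓝 0)) :
    Tendsto (fun n => rhoPow P σ p (Xs n)) atTop (𝓝 0) := by
  obtain ⟨V, x, hV, hx, -, hXV⟩ := exists_comonotone hrich hX
  have hσm := hσ.monotoneOn_ofReal
  have hxp := hx.rpow_ennreal hp.le
  have hXp : ∫⁻ ω, (X ω : ℝ≥0∞) ^ p ∂P ≠ ⊤ :=
    ne_top_of_le_ne_top hfin (lintegral_rpow_le_rhoPow hrich hσ hp.le hX)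
  have hXV' : ∀ᵐ ω ∂P, (X ω : ℝ≥0∞) = x (V ω) := by
    filter_upwards [hXV] with ω h; rw [h]
  rw [rhoPow_eq_lintegral hσ hp.le hx hV hXV'] at hfin
  have hint : Tendsto (fun n => ∫⁻ ω, Xs n ω ^ p ∂P) atTop (𝓝 0) := by
    have := tendsto_lintegral_of_dominated_convergence' (μ := P)
      (F := fun n ω => Xs n ω ^ p) (f := fun _ => 0) (fun ω => (X ω : ℝ≥0∞) ^ p)
      (fun n => (hXs n).pow_const p)
      (fun n => by filter_upwards [hle n] with ω h using ENNReal.rpow_le_rpow h hp.le) hXp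
      (by filter_upwards [hlim] with ω h
          have := h.ennrpow_const p
          rwa [ENNReal.zero_rpow_of_pos hp] at this)
    simpa using this
  set w : ℝ → ℝ≥0∞ := fun u => ENNReal.ofReal (σ u) * (x u : ℝ≥0∞) ^ p with hw
  have hwm : AEMeasurable w (volume.restrict (Ioo (0 : ℝ) 1)) :=
    (hσm.mul_ennreal hxp).aemeasurable_Ioo
  obtain ⟨a, -, ha01, halim⟩ := exists_seq_strictMono_tendsto' (zero_lt_one (α := ℝ))
  have htail : Tendsto (fun k => ∫⁻ u in Ioo (0 : ℝ) 1, (Ioi (a k)).indicator w u) atTop (𝓝 0) := by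
    have := tendsto_lintegral_of_dominated_convergence' (μ := volume.restrict (Ioo (0 : ℝ) 1))
      (F := fun k u => (Ioi (a k)).indicator w u) (f := fun _ => 0) w
      (fun k => hwm.indicator measurableSet_Ioi)
      (fun k => Eventually.of_forall fun u => indicator_le_self _ _ _) hfin
      (by filter_upwards [ae_restrict_mem measurableSet_Ioo] with u hu
          refine tendsto_const_nhds.congr' ?_
          filter_upwards [halim.eventually (lt_mem_nhds hu.2)] with k hk
          exact (indicator_of_notMem (show u ∉ Ioi (a k) from not_lt.2 hk.le) w).symm)
    simpa using this
  rw [ENNReal.tendsto_nhds_zero] at htail ⊢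
  intro ε hε
  have hε2 : 0 < ε / 2 := ENNReal.half_pos hε.ne'
  obtain ⟨k, hk⟩ := (htail (ε / 2) hε2).exists
  have h2 : Tendsto (fun n => ENNReal.ofReal (σ (a k)) * ∫⁻ ω, Xs n ω ^ p ∂P) atTop (𝓝 0) := by
    have := ENNReal.Tendsto.const_mul hint (Or.inr (ENNReal.ofReal_ne_top (r := σ (a k))))
    simpa using this
  rw [ENNReal.tendsto_nhds_zero] at h2
  filter_upwards [h2 (ε / 2) hε2] with n hn
  refine iSup₂_le fun U hU => ?_
  have hf : MonotoneOn ((Ioi (a k)).indicator fun u => ENNReal.ofReal (σ u)) (Ioo (0 : ℝ) 1) := by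
    intro u hu v hv huv
    by_cases h : a k < u
    · rw [indicator_of_mem (show u ∈ Ioi (a k) from h),
        indicator_of_mem (show v ∈ Ioi (a k) from lt_of_lt_of_le h huv)]
      exact hσm hu hv huv
    · rw [indicator_of_notMem (show u ∉ Ioi (a k) from h)]
      exact zero_le
  have hHL := lintegral_mul_comp_le (X := fun ω => (X ω : ℝ≥0∞) ^ p) hxp hV
    (by filter_upwards [hXV'] with ω h; rw [h]) hU hf
  have hHL' : ∫⁻ ω, (X ω : ℝ≥0∞) ^ p * (Ioi (a k)).indicator (fun u => ENNReal.ofReal (σ u)) (U ω) ∂P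
      ≤ ε / 2 := by
    refine hHL.trans (le_trans (le_of_eq ?_) hk)
    refine lintegral_congr fun u => ?_
    by_cases h : u ∈ Ioi (a k)
    · simp only [indicator_of_mem h, hw, mul_comm]
    · simp only [indicator_of_notMem h, mul_zero]
  calc ∫⁻ ω, ENNReal.ofReal (σ (U ω)) * Xs n ω ^ p ∂P
      ≤ ∫⁻ ω, ((X ω : ℝ≥0∞) ^ p * (Ioi (a k)).indicator (fun u => ENNReal.ofReal (σ u)) (U ω)
        + ENNReal.ofReal (σ (a k)) * Xs n ω ^ p) ∂P := by
        refine lintegral_mono_ae ?_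
        filter_upwards [hle n, hU.ae_mem_Ioo] with ω h1 h2
        by_cases h : U ω ∈ Ioi (a k)
        · rw [indicator_of_mem h]
          refine le_add_right ?_
          rw [mul_comm]
          gcongr
        · rw [indicator_of_notMem h, mul_zero, zero_add]
          gcongr
          exact hσ.mono ⟨h2.1.le, h2.2⟩ ⟨(ha01 k).1.le, (ha01 k).2⟩ (not_lt.1 h)
    _ = _ + _ := lintegral_add_right' _ (((hXs n).pow_const p).const_mul _)
    _ ≤ ε / 2 + ε / 2 := by
        rw [lintegral_const_mul'' _ ((hXs n).pow_const p)]
        exact add_le_add hHL' hn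
    _ = ε := ENNReal.add_halves ε

/-! ### The Köthe dual norm -/

/-- `sup {E[g X] : X ≥ 0, ‖X‖_{σ,p} ≤ 1}`. -/
def koetheNorm (P : Measure Ω) (σ : ℝ → ℝ) (p : ℝ) (g : Ω → ℝ≥0∞) : ℝ≥0∞ :=
  ⨆ (X : Ω → ℝ≥0) (_ : AEMeasurable X P ∧ rhoPow P σ p (fun ω => X ω) ≤ 1), ∫⁻ ω, g ω * X ω ∂P

lemma le_koetheNorm {P : Measure Ω} {σ : ℝ → ℝ} {p : ℝ} {g : Ω → ℝ≥0∞} {X : Ω → ℝ≥0}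
    (hX : AEMeasurable X P) (hX1 : rhoPow P σ p (fun ω => X ω) ≤ 1) :
    ∫⁻ ω, g ω * X ω ∂P ≤ koetheNorm P σ p g :=
  le_iSup₂_of_le X ⟨hX, hX1⟩ le_rfl

lemma koetheNorm_mono {P : Measure Ω} {σ : ℝ → ℝ} {p : ℝ} {f g : Ω → ℝ≥0∞}
    (h : ∀ᵐ ω ∂P, f ω ≤ g ω) : koetheNorm P σ p f ≤ koetheNorm P σ p g := by
  refine iSup₂_mono fun X _ => lintegral_mono_ae ?_
  filter_upwards [h] with ω hω
  gcongr

lemma koetheNorm_add_le {P : Measure Ω} {σ : ℝ → ℝ} {p : ℝ} {f g : Ω → ℝ≥0∞}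
    (hf : AEMeasurable f P) :
    koetheNorm P σ p (fun ω => f ω + g ω) ≤ koetheNorm P σ p f + koetheNorm P σ p g := by
  refine iSup₂_le fun X hX => ?_
  simp_rw [add_mul]
  rw [lintegral_add_left' (f := fun ω => f ω * X ω) (hf.mul hX.1.coe_nnreal_ennreal)]
  exact add_le_add (le_koetheNorm hX.1 hX.2) (le_koetheNorm hX.1 hX.2)

lemma lintegral_le_koetheNorm {P : Measure Ω} [IsProbabilityMeasure P]
    (hrich : ∃ U : Ω → ℝ, IsUniformRV P U) {σ : ℝ → ℝ} (hσ : IsDistortion σ) {p : ℝ} (hp : 0 ≤ p)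
    (g : Ω → ℝ≥0∞) : ∫⁻ ω, g ω ∂P ≤ koetheNorm P σ p g := by
  have h : rhoPow P σ p (fun _ : Ω => ((1 : ℝ≥0) : ℝ≥0∞)) ≤ 1 := by
    rw [rhoPow_const hrich hσ hp ENNReal.coe_ne_top]; simp
  simpa using le_koetheNorm (g := g) (X := fun _ => 1) aemeasurable_const h

lemma koetheNorm_le_liminf {P : Measure Ω} {σ : ℝ → ℝ} {p : ℝ} {g : Ω → ℝ≥0∞}
    {gs : ℕ → Ω → ℝ≥0∞} (hgs : ∀ n, AEMeasurable (gs n) P)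
    (h : ∀ᵐ ω ∂P, Tendsto (fun n => gs n ω) atTop (𝓝 (g ω))) :
    koetheNorm P σ p g ≤ liminf (fun n => koetheNorm P σ p (gs n)) atTop := by
  refine iSup₂_le fun X hX => ?_
  calc ∫⁻ ω, g ω * X ω ∂P = ∫⁻ ω, liminf (fun n => gs n ω * X ω) atTop ∂P := by
        refine lintegral_congr_ae ?_
        filter_upwards [h] with ω hω
        exact (ENNReal.Tendsto.mul_const hω (Or.inr ENNReal.coe_ne_top)).liminf_eq.symm
    _ ≤ liminf (fun n => ∫⁻ ω, gs n ω * X ω ∂P) atTop :=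
        lintegral_liminf_le' fun n => (hgs n).mul hX.1.coe_nnreal_ennreal
    _ ≤ _ := liminf_le_liminf (Eventually.of_forall fun n => le_koetheNorm hX.1 hX.2)

lemma lintegral_mul_le_koetheNorm_mul {P : Measure Ω} [IsProbabilityMeasure P]
    (hrich : ∃ U : Ω → ℝ, IsUniformRV P U) {σ : ℝ → ℝ} (hσ : IsDistortion σ) {p : ℝ} (hp : 0 < p)
    (g : Ω → ℝ≥0∞) {X : Ω → ℝ≥0} (hX : AEMeasurable X P)
    (hfin : rhoPow P σ p (fun ω => X ω) ≠ ⊤) :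
    ∫⁻ ω, g ω * X ω ∂P ≤ koetheNorm P σ p g * rhoPow P σ p (fun ω => X ω) ^ (1 / p) := by
  set R := rhoPow P σ p (fun ω => X ω) with hR
  rcases eq_or_ne R 0 with h0 | h0
  · have h1 : ∫⁻ ω, (X ω : ℝ≥0∞) ^ p ∂P = 0 :=
      le_antisymm ((lintegral_rpow_le_rhoPow hrich hσ hp.le hX).trans_eq (hR.symm.trans h0)) zero_le
    rw [lintegral_eq_zero_iff' (hX.coe_nnreal_ennreal.pow_const p)] at h1
    have h2 : ∫⁻ ω, g ω * X ω ∂P = 0 := by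
      rw [← lintegral_zero (μ := P)]
      refine lintegral_congr_ae ?_
      filter_upwards [h1] with ω hω
      have : (X ω : ℝ≥0∞) = 0 := by
        have hω' : (X ω : ℝ≥0∞) ^ p = 0 := hω
        simpa [ENNReal.rpow_eq_zero_iff, hp, hp.not_gt] using hω'
      rw [this, mul_zero]
    rw [h2]; exact zero_le
  have hc0 : R ^ (1 / p) ≠ 0 := by
    simp [ENNReal.rpow_eq_zero_iff, h0, hfin]
  have hct : R ^ (1 / p) ≠ ⊤ := ENNReal.rpow_ne_top_of_nonneg (by positivity) hfin
  obtain ⟨c, hc⟩ : ∃ x : ℝ≥0, (x : ℝ≥0∞) = _ := ⟨_, ENNReal.coe_toNNReal hct⟩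
  rw [← hc] at hc0
  have hcn : c ≠ 0 := by simpa using hc0
  have hX' : rhoPow P σ p (fun ω => ((c⁻¹ * X ω : ℝ≥0) : ℝ≥0∞)) ≤ 1 := by
    simp_rw [ENNReal.coe_mul]
    rw [rhoPow_const_mul hp.le ENNReal.coe_ne_top, ENNReal.coe_inv hcn, hc, ENNReal.inv_rpow,
      ← ENNReal.rpow_mul, one_div_mul_cancel hp.ne', ENNReal.rpow_one]
    exact (ENNReal.inv_mul_cancel h0 hfin).le
  have := le_koetheNorm (g := g) (hX.const_mul c⁻¹) hX'
  calc ∫⁻ ω, g ω * X ω ∂P = ∫⁻ ω, g ω * ((c⁻¹ * X ω : ℝ≥0) : ℝ≥0∞) * c ∂P := by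
        refine lintegral_congr fun ω => ?_
        rw [mul_assoc, ← ENNReal.coe_mul, mul_right_comm, inv_mul_cancel₀ hcn, one_mul]
    _ = (∫⁻ ω, g ω * ((c⁻¹ * X ω : ℝ≥0) : ℝ≥0∞) ∂P) * c :=
        lintegral_mul_const' _ _ ENNReal.coe_ne_top
    _ ≤ koetheNorm P σ p g * c := by gcongr
    _ = _ := by rw [hc]

/-- The lower `q`-estimate for disjoint pieces. -/
lemma koetheNorm_indicator_rpow_add_le {P : Measure Ω} [IsProbabilityMeasure P]
    (hrich : ∃ U : Ω → ℝ, IsUniformRV P U) {σ : ℝ → ℝ} (hσ : IsDistortion σ) {p q : ℝ}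
    (hpq : p.HolderConjugate q) {g : Ω → ℝ≥0∞} (hg : AEMeasurable g P) {A : Set Ω}
    (hA : MeasurableSet A) :
    koetheNorm P σ p (A.indicator g) ^ q + koetheNorm P σ p (Aᶜ.indicator g) ^ q
      ≤ koetheNorm P σ p g ^ q := by
  have hp := hpq.pos
  have hq := hpq.symm.pos
  rcases eq_or_ne (koetheNorm P σ p g) ⊤ with ht | ht
  · rw [ht, ENNReal.top_rpow_of_pos hq]; exact le_top
  have hi : ∀ B : Set Ω, koetheNorm P σ p (B.indicator g) ≠ ⊤ := fun B =>
    ne_top_of_le_ne_top ht (koetheNorm_mono (Eventually.of_forall fun ω => indicator_le_self _ _ _))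
  have key : ∀ a b : ℝ≥0, a * koetheNorm P σ p (A.indicator g)
      + b * koetheNorm P σ p (Aᶜ.indicator g)
      ≤ koetheNorm P σ p g * ((a : ℝ≥0∞) ^ p + (b : ℝ≥0∞) ^ p) ^ (1 / p) := by
    intro a b
    have h0 : AEMeasurable (fun _ : Ω => (0 : ℝ≥0)) P ∧
        rhoPow P σ p (fun _ : Ω => ((0 : ℝ≥0) : ℝ≥0∞)) ≤ 1 := by
      refine ⟨aemeasurable_const, ?_⟩
      rw [rhoPow_const hrich hσ hp.le ENNReal.coe_ne_top]; simp [hp]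
    conv_lhs => simp only [koetheNorm, ENNReal.mul_iSup]
    refine ENNReal.biSup_add_biSup_le' ⟨fun _ => 0, h0⟩ ⟨fun _ => 0, h0⟩ fun X₁ hX₁ X₂ hX₂ => ?_
    classical
    set X : Ω → ℝ≥0 := A.piecewise (fun ω => a * X₁ ω) (fun ω => b * X₂ ω) with hX
    have hXm : AEMeasurable X P := by
      rw [hX, ← indicator_add_compl_eq_piecewise]
      exact ((hX₁.1.const_mul a).indicator hA).add ((hX₂.1.const_mul b).indicator hA.compl)
    have hXr : rhoPow P σ p (fun ω => X ω) ≤ (a : ℝ≥0∞) ^ p + (b : ℝ≥0∞) ^ p := by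
      have h1 := rhoPow_const_mul (P := P) (σ := σ) hp.le (c := a) ENNReal.coe_ne_top
        (fun ω => X₁ ω)
      have h2 := rhoPow_const_mul (P := P) (σ := σ) hp.le (c := b) ENNReal.coe_ne_top
        (fun ω => X₂ ω)
      have h1' : rhoPow P σ p (fun ω => (a : ℝ≥0∞) * X₁ ω) ≤ (a : ℝ≥0∞) ^ p := by
        rw [h1]; exact mul_le_of_le_one_right zero_le hX₁.2
      have h2' : rhoPow P σ p (fun ω => (b : ℝ≥0∞) * X₂ ω) ≤ (b : ℝ≥0∞) ^ p := by
        rw [h2]; exact mul_le_of_le_one_right zero_le hX₂.2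
      refine iSup₂_le fun U hU => le_trans ?_
        (add_le_add ((le_rhoPow hU).trans h1') ((le_rhoPow hU).trans h2'))
      rw [← lintegral_add_left']
      · refine lintegral_mono fun ω => ?_
        by_cases h : ω ∈ A
        · simp only [hX, piecewise_eq_of_mem _ _ _ h, ENNReal.coe_mul]
          exact le_self_add
        · simp only [hX, piecewise_eq_of_notMem _ _ _ h, ENNReal.coe_mul]
          exact le_add_self
      · exact (hU.aemeasurable_comp hσ.monotoneOn_ofReal.aemeasurable_Ioo).mul
          ((hX₁.1.coe_nnreal_ennreal.const_mul _).pow_const p)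
    have hXfin : rhoPow P σ p (fun ω => X ω) ≠ ⊤ := by
      refine ne_top_of_le_ne_top ?_ hXr
      exact ENNReal.add_ne_top.2 ⟨ENNReal.rpow_ne_top_of_nonneg hp.le ENNReal.coe_ne_top,
        ENNReal.rpow_ne_top_of_nonneg hp.le ENNReal.coe_ne_top⟩
    calc a * ∫⁻ ω, A.indicator g ω * X₁ ω ∂P + b * ∫⁻ ω, Aᶜ.indicator g ω * X₂ ω ∂P
        = ∫⁻ ω, g ω * X ω ∂P := by
          rw [← lintegral_const_mul' _ _ ENNReal.coe_ne_top,
            ← lintegral_const_mul' _ _ ENNReal.coe_ne_top, ← lintegral_add_left']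
          · refine lintegral_congr fun ω => ?_
            by_cases h : ω ∈ A
            · simp [hX, h]; ring
            · simp [hX, h]; ring
          · exact ((hg.indicator hA).mul hX₁.1.coe_nnreal_ennreal).const_mul _
      _ ≤ _ := (lintegral_mul_le_koetheNorm_mul hrich hσ hp g hXm hXfin).trans (by gcongr)
  obtain ⟨N₁, hN₁⟩ : ∃ x : ℝ≥0, (x : ℝ≥0∞) = _ := ⟨_, ENNReal.coe_toNNReal (hi A)⟩
  obtain ⟨N₂, hN₂⟩ : ∃ x : ℝ≥0, (x : ℝ≥0∞) = _ := ⟨_, ENNReal.coe_toNNReal (hi Aᶜ)⟩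
  obtain ⟨N, hN⟩ : ∃ x : ℝ≥0, (x : ℝ≥0∞) = _ := ⟨_, ENNReal.coe_toNNReal ht⟩
  have := key (N₁ ^ (q - 1)) (N₂ ^ (q - 1))
  rw [← hN₁, ← hN₂, ← hN] at this ⊢
  have hq1 : 0 ≤ q - 1 := hpq.symm.sub_one_pos.le
  simp only [← ENNReal.coe_rpow_of_nonneg _ hq.le, ← ENNReal.coe_rpow_of_nonneg _ hp.le,
    ← ENNReal.coe_mul, ← ENNReal.coe_add,
    ← ENNReal.coe_rpow_of_nonneg _ (one_div_nonneg.2 hp.le), ENNReal.coe_le_coe,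
    ← NNReal.rpow_mul] at this ⊢
  have e1 : (q - 1) * p = q := by
    have := hpq.symm.sub_one_mul_conj; linarith
  have e2 : ∀ x : ℝ≥0, x ^ (q - 1) * x = x ^ q := fun x => by
    conv_lhs => rw [← NNReal.rpow_one x, ← NNReal.rpow_mul]
    rw [← NNReal.rpow_add_of_nonneg _ (by simpa using hq1) zero_le_one]
    congr 1; ring
  rw [e1, e2, e2] at this
  set s := N₁ ^ q + N₂ ^ q
  rcases eq_or_ne s 0 with hs | hs
  · rw [hs]; exact zero_le
  have hs1 : s = s ^ (1 / q) * s ^ (1 / p) := by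
    rw [← NNReal.rpow_add hs]
    have : 1 / q + 1 / p = 1 := by
      have := hpq.inv_add_inv_eq_one
      simp only [one_div]; linarith
    rw [this, NNReal.rpow_one]
  have h3 : s ^ (1 / q) ≤ N := by
    have hpos : 0 < s ^ (1 / p) := NNReal.rpow_pos (pos_iff_ne_zero.2 hs)
    refine le_of_mul_le_mul_right ?_ hpos
    rw [← hs1]; exact this
  calc s = (s ^ (1 / q)) ^ q := by
        rw [← NNReal.rpow_mul, one_div_mul_cancel hq.ne', NNReal.rpow_one]
    _ ≤ N ^ q := NNReal.rpow_le_rpow h3 hq.le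

/-- Order continuity of the Köthe dual norm along the upper tails of a uniform variable. -/
lemma tendsto_koetheNorm_tail {P : Measure Ω} [IsProbabilityMeasure P]
    (hrich : ∃ U : Ω → ℝ, IsUniformRV P U) {σ : ℝ → ℝ} (hσ : IsDistortion σ) {p q : ℝ}
    (hpq : p.HolderConjugate q) {g : Ω → ℝ≥0∞} (hg : AEMeasurable g P)
    (hfin : koetheNorm P σ p g ≠ ⊤) {V : Ω → ℝ} (hV : IsUniformRV P V) {a : ℕ → ℝ}
    (ha : Tendsto a atTop (𝓝 1)) :
    Tendsto (fun k => koetheNorm P σ p ({ω | a k < V ω}.indicator g)) atTop (𝓝 0) := by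
  have hq := hpq.symm.pos
  have hA : ∀ k, MeasurableSet {ω | a k < V ω} := fun k => measurableSet_lt measurable_const hV.1
  have hle : ∀ B : Set Ω, koetheNorm P σ p (B.indicator g) ≤ koetheNorm P σ p g := fun B =>
    koetheNorm_mono (Eventually.of_forall fun ω => indicator_le_self _ _ _)
  have h1 : Tendsto (fun k => koetheNorm P σ p ({ω | a k < V ω}ᶜ.indicator g)) atTop
      (𝓝 (koetheNorm P σ p g)) := by
    have hliminf := koetheNorm_le_liminf (P := P) (σ := σ) (p := p) (g := g)
      (gs := fun k => {ω | a k < V ω}ᶜ.indicator g) (fun k => hg.indicator (hA k).compl)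
      (by filter_upwards [hV.ae_mem_Ioo] with ω hω
          refine tendsto_const_nhds.congr' ?_
          filter_upwards [ha.eventually (lt_mem_nhds hω.2)] with k hk
          exact (indicator_of_mem (show ω ∈ {ω | a k < V ω}ᶜ from not_lt.2 hk.le) g).symm)
    exact tendsto_of_le_liminf_of_limsup_le hliminf
      (limsup_le_of_le (h := Eventually.of_forall fun k => hle _))
  have hqt : koetheNorm P σ p g ^ q ≠ ⊤ := ENNReal.rpow_ne_top_of_nonneg hq.le hfin
  have h2 : Tendsto (fun k => koetheNorm P σ p g ^ q
      - koetheNorm P σ p ({ω | a k < V ω}ᶜ.indicator g) ^ q) atTop (𝓝 0) := by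
    have := ENNReal.Tendsto.sub (tendsto_const_nhds (x := koetheNorm P σ p g ^ q) (f := atTop))
      (h1.ennrpow_const q) (Or.inl hqt)
    simpa using this
  have h3 : Tendsto (fun k => koetheNorm P σ p ({ω | a k < V ω}.indicator g) ^ q) atTop (𝓝 0) := by
    refine tendsto_of_tendsto_of_tendsto_of_le_of_le tendsto_const_nhds h2 (fun _ => zero_le)
      fun k => ?_
    refine ENNReal.le_sub_of_add_le_right ?_
      (koetheNorm_indicator_rpow_add_le hrich hσ hpq hg (hA k))
    exact ENNReal.rpow_ne_top_of_nonneg hq.le (ne_top_of_le_ne_top hfin (hle _))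
  have h4 := h3.ennrpow_const (1 / q)
  rw [ENNReal.zero_rpow_of_pos (one_div_pos.2 hq)] at h4
  refine h4.congr fun k => ?_
  rw [← ENNReal.rpow_mul, mul_one_div_cancel hq.ne', ENNReal.rpow_one]

/-! ### Helly selection and the maximizer -/

/-- Helly's selection theorem for monotone `[0, ∞]`-valued functions. -/
lemma exists_subseq_tendsto_of_monotoneOn {y : ℕ → ℝ → ℝ≥0∞}
    (hy : ∀ n, MonotoneOn (y n) (Ioo (0 : ℝ) 1)) :
    ∃ ψ : ℕ → ℕ, StrictMono ψ ∧
      MonotoneOn (fun u => limsup (fun k => y (ψ k) u) atTop) (Ioo (0 : ℝ) 1) ∧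
      ∀ᵐ u ∂volume.restrict (Ioo (0 : ℝ) 1),
        Tendsto (fun k => y (ψ k) u) atTop (𝓝 (limsup (fun k => y (ψ k) u) atTop)) := by
  obtain ⟨a, ψ, hψ, ha⟩ := CompactSpace.tendsto_subseq (fun n (r : ℚ) => y n r)
  rw [tendsto_pi_nhds] at ha
  set M : ℝ → ℝ≥0∞ := fun u => limsup (fun k => y (ψ k) u) atTop with hM
  set L : ℝ → ℝ≥0∞ := fun u => liminf (fun k => y (ψ k) u) atTop with hL
  have hMm : MonotoneOn M (Ioo (0 : ℝ) 1) := fun u hu v hv huv =>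
    limsup_le_limsup (Eventually.of_forall fun k => hy _ hu hv huv)
  have hLm : MonotoneOn L (Ioo (0 : ℝ) 1) := fun u hu v hv huv =>
    liminf_le_liminf (Eventually.of_forall fun k => hy _ hu hv huv)
  have hr : ∀ r : ℚ, M r = L r := fun r => (ha r).limsup_eq.trans (ha r).liminf_eq.symm
  refine ⟨ψ, hψ, hMm, ?_⟩
  have hc := hMm.countable_not_continuousWithinAt
  rw [ae_restrict_iff' measurableSet_Ioo]
  filter_upwards [hc.ae_notMem volume] with u hu hu01
  have hcont : ContinuousWithinAt M (Ioo 0 1) u := by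
    by_contra h
    exact hu ⟨hu01, h⟩
  have hlt : ∀ v ∈ Ioo 0 u, M v ≤ L u := by
    intro v hv
    obtain ⟨r, hvr, hru⟩ := exists_rat_btwn hv.2
    have hr01 : (r : ℝ) ∈ Ioo (0 : ℝ) 1 := ⟨hv.1.trans hvr, hru.trans hu01.2⟩
    calc M v ≤ M r := hMm ⟨hv.1, hv.2.trans hu01.2⟩ hr01 hvr.le
      _ = L r := hr r
      _ ≤ L u := hLm hr01 hu01 hru.le
  have hle : M u ≤ L u := by
    have hsub : Ioo 0 u ⊆ Ioo (0 : ℝ) 1 := Ioo_subset_Ioo_right hu01.2.le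
    have : (𝓝[Ioo 0 u] u).NeBot := by
      rw [← mem_closure_iff_nhdsWithin_neBot, closure_Ioo hu01.1.ne]
      exact right_mem_Icc.2 hu01.1.le
    refine le_of_tendsto (hcont.mono hsub) ?_
    filter_upwards [self_mem_nhdsWithin] with v hv using hlt v hv
  exact tendsto_of_le_liminf_of_limsup_le hle le_rfl

lemma IsUniformRV.aemeasurable_comp_nnreal {P : Measure Ω} [IsProbabilityMeasure P] {V : Ω → ℝ}
    (hV : IsUniformRV P V) {y : ℝ → ℝ≥0} (hy : MonotoneOn (fun u => (y u : ℝ≥0∞)) (Ioo (0 : ℝ) 1)) :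
    AEMeasurable (fun ω => y (V ω)) P :=
  aemeasurable_coe_nnreal_ennreal_iff.1 (hV.aemeasurable_comp hy.aemeasurable_Ioo)

lemma ofReal_one_sub_mul_rpow_le {σ : ℝ → ℝ} (hσ : IsDistortion σ) {p : ℝ} (hp : 0 < p)
    {y : ℝ → ℝ≥0∞} (hy : MonotoneOn y (Ioo (0 : ℝ) 1))
    (hy1 : ∫⁻ u in Ioo (0 : ℝ) 1, ENNReal.ofReal (σ u) * y u ^ p ≤ 1) {α : ℝ}
    (hα : α ∈ Ioo (0 : ℝ) 1) : y α ≤ ((ENNReal.ofReal (1 - α))⁻¹) ^ (1 / p) := by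
  have h1 : ENNReal.ofReal (1 - α) * y α ^ p ≤ 1 := by
    calc ENNReal.ofReal (1 - α) * y α ^ p
        ≤ (∫⁻ u in Ioo α 1, ENNReal.ofReal (σ u)) * y α ^ p := by
          gcongr; exact hσ.ofReal_le_tail hα.1.le hα.2
      _ ≤ ∫⁻ u in Ioo α 1, ENNReal.ofReal (σ u) * y α ^ p := lintegral_mul_const_le _ _
      _ ≤ ∫⁻ u in Ioo α 1, ENNReal.ofReal (σ u) * y u ^ p := by
          refine setLIntegral_mono' measurableSet_Ioo fun u hu => ?_
          gcongr
          exact hy hα ⟨hα.1.trans hu.1, hu.2⟩ hu.1.le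
      _ ≤ ∫⁻ u in Ioo (0 : ℝ) 1, ENNReal.ofReal (σ u) * y u ^ p :=
          lintegral_mono_set (Ioo_subset_Ioo_left hα.1.le)
      _ ≤ 1 := hy1
  rw [mul_comm] at h1
  have h2 := ENNReal.rpow_le_rpow (ENNReal.le_inv_iff_mul_le.2 h1) (one_div_pos.2 hp).le
  rwa [← ENNReal.rpow_mul, mul_one_div_cancel hp.ne', ENNReal.rpow_one] at h2

lemma setLIntegral_mul_le_koetheNorm_indicator {P : Measure Ω} [IsProbabilityMeasure P]
    {σ : ℝ → ℝ} (hσ : IsDistortion σ) {p : ℝ} (hp : 0 < p) {g : Ω → ℝ≥0} {V : Ω → ℝ}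
    {z y : ℝ → ℝ≥0} (hV : IsUniformRV P V)
    (hz : MonotoneOn (fun u => (z u : ℝ≥0∞)) (Ioo (0 : ℝ) 1)) (hgV : ∀ᵐ ω ∂P, g ω = z (V ω))
    (hy : MonotoneOn (fun u => (y u : ℝ≥0∞)) (Ioo (0 : ℝ) 1))
    (hy1 : ∫⁻ u in Ioo (0 : ℝ) 1, ENNReal.ofReal (σ u) * (y u : ℝ≥0∞) ^ p ≤ 1) {α : ℝ}
    (hα : 0 ≤ α) :
    ∫⁻ u in Ioo α 1, (z u : ℝ≥0∞) * y u
      ≤ koetheNorm P σ p ({ω | α < V ω}.indicator fun ω => (g ω : ℝ≥0∞)) := by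
  have hm := (hz.mul_ennreal hy).aemeasurable_Ioo
  rw [← hV.setLIntegral_comp hm hα,
    ← lintegral_indicator (measurableSet_lt measurable_const hV.1)]
  refine le_trans (le_of_eq (lintegral_congr_ae ?_))
    (le_koetheNorm (X := fun ω => y (V ω)) (hV.aemeasurable_comp_nnreal hy) ?_)
  · filter_upwards [hgV] with ω hω
    by_cases h : α < V ω <;> simp [indicator, h, hω]
  · rw [rhoPow_eq_lintegral hσ hp.le hy hV (Eventually.of_forall fun _ => rfl)]
    exact hy1

lemma lintegral_mul_le_koetheNorm {P : Measure Ω} [IsProbabilityMeasure P]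
    {σ : ℝ → ℝ} (hσ : IsDistortion σ) {p : ℝ} (hp : 0 < p) {g : Ω → ℝ≥0} {V : Ω → ℝ}
    {z y : ℝ → ℝ≥0} (hV : IsUniformRV P V)
    (hz : MonotoneOn (fun u => (z u : ℝ≥0∞)) (Ioo (0 : ℝ) 1)) (hgV : ∀ᵐ ω ∂P, g ω = z (V ω))
    (hy : MonotoneOn (fun u => (y u : ℝ≥0∞)) (Ioo (0 : ℝ) 1))
    (hy1 : ∫⁻ u in Ioo (0 : ℝ) 1, ENNReal.ofReal (σ u) * (y u : ℝ≥0∞) ^ p ≤ 1) :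
    ∫⁻ u in Ioo (0 : ℝ) 1, (z u : ℝ≥0∞) * y u ≤ koetheNorm P σ p fun ω => g ω :=
  (setLIntegral_mul_le_koetheNorm_indicator hσ hp hV hz hgV hy hy1 le_rfl).trans
    (koetheNorm_mono (Eventually.of_forall fun _ => indicator_le_self _ _ _))

lemma exists_koetheNorm_le_add {P : Measure Ω} [IsProbabilityMeasure P]
    (hrich : ∃ U : Ω → ℝ, IsUniformRV P U) {σ : ℝ → ℝ} (hσ : IsDistortion σ) {p : ℝ} (hp : 0 < p)
    {g : Ω → ℝ≥0∞} (hfin : koetheNorm P σ p g ≠ ⊤) {ε : ℝ≥0∞} (hε : ε ≠ 0) :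
    ∃ X : Ω → ℝ≥0, AEMeasurable X P ∧ rhoPow P σ p (fun ω => X ω) ≤ 1 ∧
      koetheNorm P σ p g ≤ (∫⁻ ω, g ω * X ω ∂P) + ε := by
  by_contra! h
  have h0 : ε < koetheNorm P σ p g := by
    have := h 0 aemeasurable_const (by
      have := rhoPow_const hrich hσ hp.le (c := 0) ENNReal.zero_ne_top
      simp only [Pi.zero_apply, ENNReal.coe_zero, this]
      simp [hp])
    simpa using this
  have h1 : koetheNorm P σ p g ≤ koetheNorm P σ p g - ε := by
    refine iSup₂_le fun X hX => ?_
    exact ENNReal.le_sub_of_add_le_right h0.ne_top (h X hX.1 hX.2).le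
  exact absurd h1 (not_le.2 (ENNReal.sub_lt_self hfin (zero_le.trans_lt h0).ne' hε))

/-- The supremum defining the Köthe dual norm is attained, comonotonically with `g`. -/
lemma exists_maximizer {P : Measure Ω} [IsProbabilityMeasure P]
    (hrich : ∃ U : Ω → ℝ, IsUniformRV P U) {σ : ℝ → ℝ} (hσ : IsDistortion σ) {p q : ℝ}
    (hpq : p.HolderConjugate q) {g : Ω → ℝ≥0} (hg : AEMeasurable g P) {V : Ω → ℝ}
    {z : ℝ → ℝ≥0} (hV : IsUniformRV P V)
    (hz : MonotoneOn (fun u => (z u : ℝ≥0∞)) (Ioo (0 : ℝ) 1)) (hgV : ∀ᵐ ω ∂P, g ω = z (V ω))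
    (hfin : koetheNorm P σ p (fun ω => g ω) ≠ ⊤) :
    ∃ y : ℝ → ℝ≥0, MonotoneOn (fun u => (y u : ℝ≥0∞)) (Ioo (0 : ℝ) 1) ∧
      ∫⁻ u in Ioo (0 : ℝ) 1, ENNReal.ofReal (σ u) * (y u : ℝ≥0∞) ^ p ≤ 1 ∧
      ∫⁻ u in Ioo (0 : ℝ) 1, (z u : ℝ≥0∞) * y u = koetheNorm P σ p fun ω => g ω := by
  have hp := hpq.pos
  set N := koetheNorm P σ p (fun ω => g ω) with hN
  have hgV' : ∀ᵐ ω ∂P, (g ω : ℝ≥0∞) = z (V ω) := by filter_upwards [hgV] with ω h; rw [h]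
  have happ : ∀ n : ℕ, ∃ y : ℝ → ℝ≥0, MonotoneOn (fun u => (y u : ℝ≥0∞)) (Ioo (0 : ℝ) 1) ∧
      ∫⁻ u in Ioo (0 : ℝ) 1, ENNReal.ofReal (σ u) * (y u : ℝ≥0∞) ^ p ≤ 1 ∧
      N ≤ (∫⁻ u in Ioo (0 : ℝ) 1, (z u : ℝ≥0∞) * y u) + ((n : ℝ≥0∞))⁻¹ := by
    intro n
    obtain ⟨X, hX, hX1, hXN⟩ := exists_koetheNorm_le_add hrich hσ hp hfin
      (ENNReal.inv_ne_zero.2 (ENNReal.natCast_ne_top n))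
    obtain ⟨W, y, hW, hy, -, hXW⟩ := exists_comonotone hrich hX
    have hXW' : ∀ᵐ ω ∂P, (X ω : ℝ≥0∞) = y (W ω) := by filter_upwards [hXW] with ω h; rw [h]
    refine ⟨y, hy, ?_, hXN.trans ?_⟩
    · rw [← rhoPow_eq_lintegral hσ hp.le hy hW hXW']; exact hX1
    · gcongr
      refine le_trans (le_of_eq (lintegral_congr_ae ?_)) (lintegral_mul_comp_le hz hV hgV' hW hy)
      filter_upwards [hXW] with ω h
      rw [h]
  choose y hy hy1 hyN using happ
  obtain ⟨ψ, hψ, hMm, hlim⟩ := exists_subseq_tendsto_of_monotoneOn hy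
  set M : ℝ → ℝ≥0∞ := fun u => limsup (fun k => (y (ψ k) u : ℝ≥0∞)) atTop with hM
  set b : ℝ → ℝ≥0∞ := fun α => ((ENNReal.ofReal (1 - α))⁻¹) ^ (1 / p) with hb
  have hyb : ∀ n, ∀ α ∈ Ioo (0 : ℝ) 1, (y n α : ℝ≥0∞) ≤ b α := fun n α hα =>
    ofReal_one_sub_mul_rpow_le hσ hp (hy n) (hy1 n) hα
  have hbfin : ∀ α ∈ Ioo (0 : ℝ) 1, b α ≠ ⊤ := fun α hα =>
    ENNReal.rpow_ne_top_of_nonneg (one_div_pos.2 hp).le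
      (ENNReal.inv_ne_top.2 (ENNReal.ofReal_pos.2 (sub_pos.2 hα.2)).ne')
  have hMb : ∀ α ∈ Ioo (0 : ℝ) 1, M α ≤ b α := fun α hα =>
    limsup_le_of_le (h := Eventually.of_forall fun k => hyb _ α hα)
  have hcoe : ∀ α ∈ Ioo (0 : ℝ) 1, ((M α).toNNReal : ℝ≥0∞) = M α := fun α hα =>
    ENNReal.coe_toNNReal (ne_top_of_le_ne_top (hbfin α hα) (hMb α hα))
  have hym : MonotoneOn (fun u => ((M u).toNNReal : ℝ≥0∞)) (Ioo (0 : ℝ) 1) := by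
    intro u hu v hv huv
    simp only [hcoe u hu, hcoe v hv]
    exact hMm hu hv huv
  have hlim' : ∀ᵐ u ∂volume.restrict (Ioo (0 : ℝ) 1),
      Tendsto (fun k => (y (ψ k) u : ℝ≥0∞)) atTop (𝓝 ((M u).toNNReal : ℝ≥0∞)) := by
    filter_upwards [hlim, ae_restrict_mem measurableSet_Ioo] with u hu h01
    rw [hcoe u h01]; exact hu
  have hσm := hσ.monotoneOn_ofReal
  have hy1' : ∫⁻ u in Ioo (0 : ℝ) 1, ENNReal.ofReal (σ u) * ((M u).toNNReal : ℝ≥0∞) ^ p ≤ 1 := by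
    calc ∫⁻ u in Ioo (0 : ℝ) 1, ENNReal.ofReal (σ u) * ((M u).toNNReal : ℝ≥0∞) ^ p
        = ∫⁻ u in Ioo (0 : ℝ) 1,
            liminf (fun k => ENNReal.ofReal (σ u) * (y (ψ k) u : ℝ≥0∞) ^ p) atTop := by
          refine lintegral_congr_ae ?_
          filter_upwards [hlim'] with u hu
          exact (ENNReal.Tendsto.const_mul (hu.ennrpow_const p)
            (Or.inr ENNReal.ofReal_ne_top)).liminf_eq.symm
      _ ≤ liminf (fun k => ∫⁻ u in Ioo (0 : ℝ) 1,
            ENNReal.ofReal (σ u) * (y (ψ k) u : ℝ≥0∞) ^ p) atTop :=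
          lintegral_liminf_le' fun k =>
            (hσm.mul_ennreal ((hy _).rpow_ennreal hp.le)).aemeasurable_Ioo
      _ ≤ 1 := by
          refine (liminf_le_liminf (Eventually.of_forall fun k => hy1 (ψ k))).trans ?_
          simp
  refine ⟨fun u => (M u).toNNReal, hym, hy1', le_antisymm
    (lintegral_mul_le_koetheNorm hσ hp hV hz hgV hym hy1') ?_⟩
  have hzint : ∫⁻ u in Ioo (0 : ℝ) 1, (z u : ℝ≥0∞) ≠ ⊤ := by
    rw [← hV.lintegral_comp hz.aemeasurable_Ioo, ← lintegral_congr_ae hgV']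
    exact ne_top_of_le_ne_top hfin (lintegral_le_koetheNorm hrich hσ hp.le _)
  set I := ∫⁻ u in Ioo (0 : ℝ) 1, (z u : ℝ≥0∞) * ((M u).toNNReal : ℝ≥0∞) with hI
  have hα : ∀ α ∈ Ioo (0 : ℝ) 1,
      N ≤ I + koetheNorm P σ p ({ω | α < V ω}.indicator fun ω => (g ω : ℝ≥0∞)) := by
    intro α hα
    set τ := koetheNorm P σ p ({ω | α < V ω}.indicator fun ω => (g ω : ℝ≥0∞)) with hτ
    have hsub : Ioc 0 α ⊆ Ioo (0 : ℝ) 1 := fun u hu => ⟨hu.1, hu.2.trans_lt hα.2⟩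
    have hT : Tendsto (fun k => ∫⁻ u in Ioc 0 α, (z u : ℝ≥0∞) * y (ψ k) u) atTop
        (𝓝 (∫⁻ u in Ioc 0 α, (z u : ℝ≥0∞) * ((M u).toNNReal : ℝ≥0∞))) := by
      refine tendsto_lintegral_of_dominated_convergence' (fun u => (z u : ℝ≥0∞) * b α)
        (fun k => ?_) (fun k => ?_) ?_ ?_
      · exact (hz.mul_ennreal (hy _)).aemeasurable_Ioo.mono_measure (Measure.restrict_mono hsub le_rfl)
      · filter_upwards [ae_restrict_mem measurableSet_Ioc] with u hu
        gcongr
        exact (hy _ (hsub hu) hα hu.2).trans (hyb _ α hα)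
      · rw [lintegral_mul_const' _ _ (hbfin α hα)]
        exact ENNReal.mul_ne_top (ne_top_of_le_ne_top hzint (lintegral_mono_set hsub))
          (hbfin α hα)
      · filter_upwards [ae_mono (Measure.restrict_mono hsub le_rfl) hlim'] with u hu
        exact ENNReal.Tendsto.const_mul hu (Or.inr ENNReal.coe_ne_top)
    have hN' : Tendsto (fun k => (∫⁻ u in Ioc 0 α, (z u : ℝ≥0∞) * y (ψ k) u) + τ
        + ((ψ k : ℕ) : ℝ≥0∞)⁻¹) atTop
        (𝓝 ((∫⁻ u in Ioc 0 α, (z u : ℝ≥0∞) * ((M u).toNNReal : ℝ≥0∞)) + τ + 0)) :=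
      (hT.add tendsto_const_nhds).add
        (ENNReal.tendsto_inv_nat_nhds_zero.comp hψ.tendsto_atTop)
    rw [add_zero] at hN'
    refine (ge_of_tendsto' hN' fun k => ?_).trans
      (add_le_add (lintegral_mono_set hsub) le_rfl)
    refine (hyN (ψ k)).trans ?_
    rw [setLIntegral_Ioo_add hα.1.le hα.2]
    gcongr
    exact setLIntegral_mul_le_koetheNorm_indicator hσ hp hV hz hgV (hy _) (hy1 _) hα.1.le
  have ha : Tendsto (fun k : ℕ => 1 - 1 / ((k : ℝ) + 2)) atTop (𝓝 1) := by
    have h := (tendsto_one_div_add_atTop_nhds_zero_nat (𝕜 := ℝ)).comp (tendsto_add_atTop_nat 1)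
    have h' := h.const_sub 1
    rw [sub_zero] at h'
    refine h'.congr fun k => ?_
    simp only [Function.comp_apply, Nat.cast_add, Nat.cast_one]
    ring_nf
  have ht := (tendsto_koetheNorm_tail hrich hσ hpq hg.coe_nnreal_ennreal hfin hV ha).const_add I
  rw [add_zero] at ht
  refine ge_of_tendsto' ht fun k => hα _ ?_
  have hk : (0 : ℝ) < (k : ℝ) + 2 := by positivity
  constructor
  · rw [sub_pos, div_lt_one hk]; linarith [(Nat.cast_nonneg k : (0 : ℝ) ≤ k)]
  · have := one_div_pos.2 hk; linarith

/-! ### First-order condition at the maximizer -/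

lemma coe_add_rpow_le {p : ℝ} (hp : 1 ≤ p) (a t : ℝ≥0) :
    ((a : ℝ≥0∞) + t) ^ p ≤ (a : ℝ≥0∞) ^ p + ENNReal.ofReal p * t * ((a : ℝ≥0∞) + t) ^ (p - 1) := by
  have hp0 : 0 ≤ p := zero_le_one.trans hp
  have hp1 : 0 ≤ p - 1 := sub_nonneg.2 hp
  have key : ((a : ℝ) + t) ^ p ≤ (a : ℝ) ^ p + p * t * ((a : ℝ) + t) ^ (p - 1) := by
    rcases eq_or_lt_of_le (add_nonneg a.2 t.2 : (0 : ℝ) ≤ a + t) with h | h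
    · have ha : (a : ℝ) = 0 := le_antisymm (by linarith [t.2]) a.2
      have ht : (t : ℝ) = 0 := le_antisymm (by linarith [a.2]) t.2
      simp [ha, ht]
    · set s : ℝ := a + t with hs
      have hb := one_add_mul_self_le_rpow_one_add (s := -(t / s)) (by
        rw [neg_le_neg_iff, div_le_one h, hs]; linarith [a.2]) hp
      have hsp : s ^ p = s ^ (p - 1) * s := by
        rw [← Real.rpow_add_one h.ne']; congr 1; ring
      have ha : (a : ℝ) ^ p = s ^ p * (1 + -(t / s)) ^ p := by
        rw [← Real.mul_rpow h.le (by
          rw [← sub_eq_add_neg, sub_nonneg, div_le_one h, hs]; linarith [a.2])]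
        congr 1
        field_simp
        rw [hs]; ring
      have h2 := mul_le_mul_of_nonneg_left hb (Real.rpow_nonneg h.le p)
      rw [← ha] at h2
      have h3 : s ^ p * (1 + p * -(t / s)) = s ^ p - p * t * s ^ (p - 1) := by
        rw [hsp]; field_simp; ring
      linarith
  have e : ENNReal.ofReal p = ((NNReal.mk p hp0 : ℝ≥0) : ℝ≥0∞) := ENNReal.ofReal_eq_coe_nnreal hp0
  rw [e, ← ENNReal.coe_add, ← ENNReal.coe_rpow_of_nonneg _ hp0, ← ENNReal.coe_rpow_of_nonneg _ hp0,
    ← ENNReal.coe_rpow_of_nonneg _ hp1, ← ENNReal.coe_mul, ← ENNReal.coe_mul, ← ENNReal.coe_add,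
    ENNReal.coe_le_coe, ← NNReal.coe_le_coe]
  exact_mod_cast key

lemma one_add_mul_rpow_inv_le {p : ℝ} (hp : 1 ≤ p) {x : ℝ≥0∞} (hx : x ≠ ⊤) :
    (1 + ENNReal.ofReal p * x) ^ (1 / p) ≤ 1 + x := by
  have hp0 : 0 < p := zero_lt_one.trans_le hp
  lift x to ℝ≥0 using hx
  have key : (1 + p * (x : ℝ)) ^ (1 / p) ≤ 1 + x := by
    have := rpow_one_add_le_one_add_mul_self (s := p * x) (p := 1 / p)
      (by nlinarith [x.2]) (by positivity) (by rw [div_le_one hp0]; exact hp)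
    refine this.trans_eq ?_
    field_simp
  have e : ENNReal.ofReal p = ((NNReal.mk p hp0.le : ℝ≥0) : ℝ≥0∞) := ENNReal.ofReal_eq_coe_nnreal hp0.le
  rw [e, ← ENNReal.coe_mul, ← ENNReal.coe_one, ← ENNReal.coe_add,
    ← ENNReal.coe_rpow_of_nonneg _ (by positivity), ← ENNReal.coe_add,
    ENNReal.coe_le_coe, ← NNReal.coe_le_coe]
  exact_mod_cast key

lemma setLIntegral_tail_le_of_maximizer {P : Measure Ω} [IsProbabilityMeasure P]
    (hrich : ∃ U : Ω → ℝ, IsUniformRV P U) {σ : ℝ → ℝ} (hσ : IsDistortion σ) {p : ℝ}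
    (hp : 1 < p) {g : Ω → ℝ≥0} {V : Ω → ℝ} {z y : ℝ → ℝ≥0} (hV : IsUniformRV P V)
    (hz : MonotoneOn (fun u => (z u : ℝ≥0∞)) (Ioo (0 : ℝ) 1)) (hgV : ∀ᵐ ω ∂P, g ω = z (V ω))
    (hfin : koetheNorm P σ p (fun ω => g ω) ≠ ⊤)
    (hy : MonotoneOn (fun u => (y u : ℝ≥0∞)) (Ioo (0 : ℝ) 1))
    (hy1 : ∫⁻ u in Ioo (0 : ℝ) 1, ENNReal.ofReal (σ u) * (y u : ℝ≥0∞) ^ p ≤ 1)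
    (hmax : ∫⁻ u in Ioo (0 : ℝ) 1, (z u : ℝ≥0∞) * y u = koetheNorm P σ p fun ω => g ω)
    {α : ℝ} (hα : 0 ≤ α) :
    ∫⁻ u in Ioo α 1, (z u : ℝ≥0∞) ≤ koetheNorm P σ p (fun ω => g ω) *
      ∫⁻ u in Ioo α 1, ENNReal.ofReal (σ u) * (y u : ℝ≥0∞) ^ (p - 1) := by
  have hp0 : 0 < p := zero_lt_one.trans hp
  have hp1 : 0 ≤ p - 1 := sub_nonneg.2 hp.le
  set N := koetheNorm P σ p (fun ω => g ω) with hN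
  have hσm := hσ.monotoneOn_ofReal
  have hsub : Ioo α 1 ⊆ Ioo (0 : ℝ) 1 := Ioo_subset_Ioo_left hα
  have hres : ∀ {f : ℝ → ℝ≥0∞}, ∫⁻ u in Ioo (0 : ℝ) 1, (Ioi α).indicator f u
      = ∫⁻ u in Ioo α 1, f u := by
    intro f
    rw [lintegral_indicator measurableSet_Ioi, Measure.restrict_restrict measurableSet_Ioi]
    congr 2
    ext x; simp only [mem_inter_iff, mem_Ioi, mem_Ioo]; grind
  have hadd : ∀ t : ℝ≥0, MonotoneOn (fun u => (y u : ℝ≥0∞) + t) (Ioo (0 : ℝ) 1) :=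
    fun t u hu v hv huv => add_le_add (hy hu hv huv) le_rfl
  have hone : ∫⁻ u in Ioo (0 : ℝ) 1, ENNReal.ofReal (σ u) * ((y u : ℝ≥0∞) + (1 : ℝ≥0)) ^ p ≠ ⊤ := by
    have : ∫⁻ u in Ioo (0 : ℝ) 1, ENNReal.ofReal (σ u) * ((y u : ℝ≥0∞) + (1 : ℝ≥0)) ^ p
        ≤ ∫⁻ u in Ioo (0 : ℝ) 1, 2 ^ (p - 1) *
          (ENNReal.ofReal (σ u) * (y u : ℝ≥0∞) ^ p + ENNReal.ofReal (σ u)) := by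
      refine lintegral_mono fun u => ?_
      refine (mul_le_mul' le_rfl (ENNReal.rpow_add_le_mul_rpow_add_rpow _ _ hp.le)).trans_eq ?_
      simp only [ENNReal.coe_one, ENNReal.one_rpow]
      ring
    refine ne_top_of_le_ne_top ?_ this
    rw [lintegral_const_mul' _ _ (by finiteness), lintegral_add_right' _ hσm.aemeasurable_Ioo,
      hσ.lintegral_eq_one]
    exact ENNReal.mul_ne_top (by finiteness)
      (ENNReal.add_ne_top.2 ⟨ne_top_of_le_ne_top ENNReal.one_ne_top hy1, ENNReal.one_ne_top⟩)
  have hone' : ∫⁻ u in Ioo α 1, ENNReal.ofReal (σ u) * ((y u : ℝ≥0∞) + (1 : ℝ≥0)) ^ (p - 1) ≠ ⊤ := by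
    refine ne_top_of_le_ne_top hone ((lintegral_mono_set hsub).trans (lintegral_mono fun u => ?_))
    gcongr
    · simp
    · linarith
  set D : ℝ≥0 → ℝ≥0∞ := fun t =>
    ∫⁻ u in Ioo α 1, ENNReal.ofReal (σ u) * ((y u : ℝ≥0∞) + t) ^ (p - 1) with hD
  have hstep : ∀ t : ℝ≥0, t ≠ 0 → t ≤ 1 → ∫⁻ u in Ioo α 1, (z u : ℝ≥0∞) ≤ N * D t := by
    intro t ht ht1
    have hDt : D t ≠ ⊤ := by
      refine ne_top_of_le_ne_top hone' (lintegral_mono fun u => ?_)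
      gcongr
    set yt : ℝ → ℝ≥0 := fun u => y u + (Ioi α).indicator (fun _ => t) u with hyt
    have hytm : MonotoneOn (fun u => (yt u : ℝ≥0∞)) (Ioo (0 : ℝ) 1) := by
      intro u hu v hv huv
      refine ENNReal.coe_le_coe.2 (add_le_add (ENNReal.coe_le_coe.1 (hy hu hv huv)) ?_)
      by_cases h : α < u
      · simp [indicator, h, h.trans_le huv]
      · simp [indicator, h]
    have hR : ∫⁻ u in Ioo (0 : ℝ) 1, ENNReal.ofReal (σ u) * (yt u : ℝ≥0∞) ^ p
        ≤ 1 + ENNReal.ofReal p * (t * D t) := by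
      calc ∫⁻ u in Ioo (0 : ℝ) 1, ENNReal.ofReal (σ u) * (yt u : ℝ≥0∞) ^ p
          ≤ ∫⁻ u in Ioo (0 : ℝ) 1, (ENNReal.ofReal (σ u) * (y u : ℝ≥0∞) ^ p
              + (Ioi α).indicator (fun u => (ENNReal.ofReal p * t) *
                (ENNReal.ofReal (σ u) * ((y u : ℝ≥0∞) + t) ^ (p - 1))) u) := by
            refine lintegral_mono fun u => ?_
            by_cases h : α < u
            · simp only [hyt, indicator, mem_Ioi, h, if_true, ENNReal.coe_add]
              refine (mul_le_mul' le_rfl (coe_add_rpow_le hp.le _ _)).trans_eq ?_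
              ring
            · simp [hyt, indicator, h]
        _ = (∫⁻ u in Ioo (0 : ℝ) 1, ENNReal.ofReal (σ u) * (y u : ℝ≥0∞) ^ p)
              + ENNReal.ofReal p * t * D t := by
            rw [lintegral_add_left' (hσm.mul_ennreal (hy.rpow_ennreal hp0.le)).aemeasurable_Ioo,
              hres, lintegral_const_mul' _ _ (by finiteness)]
        _ ≤ _ := by rw [mul_assoc]; gcongr
    have hX := hV.aemeasurable_comp_nnreal hytm
    have hrho := rhoPow_eq_lintegral (p := p) (X := fun ω => (yt (V ω) : ℝ≥0∞)) hσ hp0.le hytm hV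
      (Eventually.of_forall fun _ => rfl)
    have htD : (t : ℝ≥0∞) * D t ≠ ⊤ := ENNReal.mul_ne_top ENNReal.coe_ne_top hDt
    have hmain := lintegral_mul_le_koetheNorm_mul hrich hσ hp0 (fun ω => (g ω : ℝ≥0∞)) hX (by
      rw [hrho]
      refine ne_top_of_le_ne_top ?_ hR
      exact ENNReal.add_ne_top.2 ⟨ENNReal.one_ne_top, ENNReal.mul_ne_top ENNReal.ofReal_ne_top htD⟩)
    rw [hrho, ← hN] at hmain
    have hlhs : ∫⁻ ω, (g ω : ℝ≥0∞) * yt (V ω) ∂P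
        = N + t * ∫⁻ u in Ioo α 1, (z u : ℝ≥0∞) := by
      rw [← hmax, ← lintegral_const_mul' _ _ ENNReal.coe_ne_top, ← hres,
        ← lintegral_add_left' (hz.mul_ennreal hy).aemeasurable_Ioo,
        ← hV.lintegral_comp]
      · refine lintegral_congr_ae ?_
        filter_upwards [hgV] with ω h
        rw [h]
        by_cases h : α < V ω
        · simp [hyt, indicator, h]; ring
        · simp [hyt, indicator, h]
      · exact (hz.mul_ennreal hy).aemeasurable_Ioo.add
          ((hz.aemeasurable_Ioo.const_mul _).indicator measurableSet_Ioi)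
    have h5 : N + t * ∫⁻ u in Ioo α 1, (z u : ℝ≥0∞) ≤ N + t * (N * D t) := by
      calc N + t * ∫⁻ u in Ioo α 1, (z u : ℝ≥0∞)
          ≤ N * (1 + ENNReal.ofReal p * (t * D t)) ^ (1 / p) := by
            rw [← hlhs]; exact hmain.trans (by gcongr)
        _ ≤ N * (1 + t * D t) := by gcongr; exact one_add_mul_rpow_inv_le hp.le htD
        _ = N + t * (N * D t) := by ring
    have h6 := (ENNReal.add_le_add_iff_left hfin).1 h5
    exact (ENNReal.mul_le_mul_iff_right (by simpa using ht) ENNReal.coe_ne_top).1 h6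
  have hlim : Tendsto (fun n : ℕ => D ((n : ℝ≥0) + 1)⁻¹) atTop
      (𝓝 (∫⁻ u in Ioo α 1, ENNReal.ofReal (σ u) * (y u : ℝ≥0∞) ^ (p - 1))) := by
    refine tendsto_lintegral_of_dominated_convergence'
      (fun u => ENNReal.ofReal (σ u) * ((y u : ℝ≥0∞) + (1 : ℝ≥0)) ^ (p - 1)) (fun n => ?_)
      (fun n => Eventually.of_forall fun u => ?_) hone' (Eventually.of_forall fun u => ?_)
    · exact (hσm.mul_ennreal ((hadd _).rpow_ennreal hp1)).aemeasurable_Ioo.mono_measure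
        (Measure.restrict_mono hsub le_rfl)
    · dsimp only
      gcongr
      exact inv_le_one_of_one_le₀ (by simp)
    · refine ENNReal.Tendsto.const_mul (Tendsto.ennrpow_const _ ?_) (Or.inr ENNReal.ofReal_ne_top)
      have h : Tendsto (fun n : ℕ => ((n : ℝ≥0) + 1)⁻¹) atTop (𝓝 0) := by
        simpa [one_div] using tendsto_one_div_add_atTop_nhds_zero_nat (𝕜 := ℝ≥0)
      have := (ENNReal.tendsto_coe.2 h).const_add (y u : ℝ≥0∞)
      simpa using this
  exact ge_of_tendsto' (ENNReal.Tendsto.const_mul hlim (Or.inr hfin)) fun n =>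
    hstep _ (by positivity) (inv_le_one_of_one_le₀ (by simp))

/-! ### The dual norm as a Köthe dual norm -/

lemma exists_comonotone_real {P : Measure Ω} [IsProbabilityMeasure P]
    (hrich : ∃ U : Ω → ℝ, IsUniformRV P U) {g : Ω → ℝ} (hg : AEMeasurable g P)
    (h0 : ∀ᵐ ω ∂P, 0 ≤ g ω) :
    ∃ V : Ω → ℝ, IsUniformRV P V ∧
      MonotoneOn (fun u => ENNReal.ofReal (quantileFn P g u)) (Ioo (0 : ℝ) 1) ∧
      ∀ᵐ ω ∂P, ENNReal.ofReal (g ω) = ENNReal.ofReal (quantileFn P g (V ω)) := by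
  obtain ⟨V, hV, h⟩ := exists_uniform_quantileFn hrich hg h0
  refine ⟨V, hV, fun u hu v hv huv =>
    ENNReal.ofReal_le_ofReal (quantileFn_monotoneOn h0 hu hv huv), ?_⟩
  filter_upwards [h] with ω hω
  rw [← hω]

lemma setLIntegral_le_lintegral_quantileFn {P : Measure Ω} [IsProbabilityMeasure P]
    {g : Ω → ℝ} (hg : AEMeasurable g P) (h0 : ∀ᵐ ω ∂P, 0 ≤ g ω) {W : Ω → ℝ} (hW : IsUniformRV P W)
    {α : ℝ} (hα : 0 ≤ α) :
    ∫⁻ ω in {ω | α < W ω}, ENNReal.ofReal (g ω) ∂P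
      ≤ ∫⁻ u in Ioo α 1, ENNReal.ofReal (quantileFn P g u) := by
  obtain ⟨V, hV, hm, hgV⟩ := exists_comonotone_real ⟨W, hW⟩ hg h0
  refine (setLIntegral_tail_le hm hV hgV hW hα).trans_eq ?_
  rw [← hV.setLIntegral_comp hm.aemeasurable_Ioo hα]
  exact lintegral_congr_ae (ae_restrict_of_ae hgV)

lemma avar_le_avar_iff {P : Measure Ω} {f g : Ω → ℝ} {α : ℝ} (hα : α < 1) :
    avar P f α ≤ avar P g α ↔ ∫⁻ u in Ioo α 1, ENNReal.ofReal (quantileFn P f u)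
      ≤ ∫⁻ u in Ioo α 1, ENNReal.ofReal (quantileFn P g u) :=
  ENNReal.mul_le_mul_iff_right
    (ENNReal.ofReal_pos.2 (one_div_pos.2 (sub_pos.2 hα))).ne' ENNReal.ofReal_ne_top

lemma IsUniformRV.aemeasurable_distortion {P : Measure Ω} [IsProbabilityMeasure P] {U : Ω → ℝ}
    (hU : IsUniformRV P U) {σ : ℝ → ℝ} (hσ : IsDistortion σ) :
    AEMeasurable (fun ω => σ (U ω)) P :=
  hU.aemeasurable_comp (aemeasurable_restrict_of_monotoneOn measurableSet_Ioo
    (hσ.mono.mono Ioo_subset_Ico_self))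

lemma IsUniformRV.distortion_nonneg {P : Measure Ω} [IsProbabilityMeasure P] {U : Ω → ℝ}
    (hU : IsUniformRV P U) {σ : ℝ → ℝ} (hσ : IsDistortion σ) : ∀ᵐ ω ∂P, 0 ≤ σ (U ω) := by
  filter_upwards [hU.ae_mem_Ioo] with ω hω using hσ.nonneg _ ⟨hω.1.le, hω.2⟩

lemma dualNormQ_le_koetheNorm {P : Measure Ω} [IsProbabilityMeasure P]
    (hrich : ∃ U : Ω → ℝ, IsUniformRV P U) {σ : ℝ → ℝ} (hσ : IsDistortion σ) {p q : ℝ}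
    (hpq : p.HolderConjugate q) {Z : Ω → 𝕂} (hZ : AEStronglyMeasurable Z P) :
    dualNormQ P σ q Z ≤ koetheNorm P σ p fun ω => (‖Z ω‖₊ : ℝ≥0∞) := by
  rcases eq_or_ne (koetheNorm P σ p fun ω => (‖Z ω‖₊ : ℝ≥0∞)) ⊤ with htop | hfin
  · rw [htop]; exact le_top
  have hq := hpq.symm.pos
  have hp1 : 0 ≤ p - 1 := hpq.sub_one_pos.le
  have hσm := hσ.monotoneOn_ofReal
  have hZm : AEMeasurable (fun ω => ‖Z ω‖₊) P := hZ.aemeasurable.nnnorm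
  obtain ⟨V, z, hV, hz, hzq, hZV⟩ := exists_comonotone hrich hZm
  obtain ⟨y, hy, hy1, hmax⟩ := exists_maximizer hrich hσ hpq hZm hV hz hZV hfin
  have hfo := fun {α : ℝ} (hα : 0 ≤ α) =>
    setLIntegral_tail_le_of_maximizer hrich hσ hpq.lt hV hz hZV hfin hy hy1 hmax hα
  obtain ⟨c, hc⟩ : ∃ x : ℝ≥0, (x : ℝ≥0∞) = _ := ⟨_, ENNReal.coe_toNNReal hfin⟩
  rw [← hc] at hfo ⊢
  set h : ℝ → ℝ≥0 := fun u => c * y u ^ (p - 1) with hh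
  have hcoe : ∀ u, (h u : ℝ≥0∞) = c * (y u : ℝ≥0∞) ^ (p - 1) := fun u => by
    rw [hh, ENNReal.coe_mul, ENNReal.coe_rpow_of_nonneg _ hp1]
  have hhm : MonotoneOn (fun u => (h u : ℝ≥0∞)) (Ioo (0 : ℝ) 1) := by
    intro u hu v hv huv
    simp only [hcoe]
    gcongr
    exact ENNReal.coe_le_coe.1 (hy hu hv huv)
  have hhV := hV.aemeasurable_comp_nnreal hhm
  have hnorm : ∀ ω, ‖(((h (V ω) : ℝ≥0) : ℝ) : 𝕂)‖ = h (V ω) := fun ω => by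
    rw [RCLike.norm_ofReal, abs_of_nonneg (NNReal.coe_nonneg _)]
  set Z' : Ω → 𝕂 := fun ω => (((h (V ω) : ℝ≥0) : ℝ) : 𝕂) with hZ'
  have hZ'm : AEStronglyMeasurable Z' P :=
    (RCLike.measurable_ofReal.comp_aemeasurable hhV.coe_nnreal_real).aestronglyMeasurable
  refine (iInf₂_le Z' ⟨hZ'm, V, hV, fun α hα => ?_⟩).trans ?_
  swap
  · rw [avar_le_avar_iff hα.2]
    calc ∫⁻ u in Ioo α 1, ENNReal.ofReal (quantileFn P (fun ω => ‖Z ω‖) u)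
        = ∫⁻ u in Ioo α 1, (z u : ℝ≥0∞) := lintegral_congr fun u => (hzq u).symm
      _ ≤ c * ∫⁻ u in Ioo α 1, ENNReal.ofReal (σ u) * (y u : ℝ≥0∞) ^ (p - 1) := hfo hα.1
      _ = ∫⁻ u in Ioo α 1, ENNReal.ofReal (σ u) * h u := by
          rw [← lintegral_const_mul' _ _ ENNReal.coe_ne_top]
          refine lintegral_congr fun u => ?_
          rw [hcoe]; ring
      _ = ∫⁻ ω in {ω | α < V ω}, ENNReal.ofReal (σ (V ω) * ‖Z' ω‖) ∂P := by
          rw [← hV.setLIntegral_comp (hσm.mul_ennreal hhm).aemeasurable_Ioo hα.1]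
          refine lintegral_congr fun ω => ?_
          rw [hnorm, ENNReal.ofReal_mul' (NNReal.coe_nonneg _), ENNReal.ofReal_coe_nnreal]
      _ ≤ _ := by
          refine setLIntegral_le_lintegral_quantileFn
            ((hV.aemeasurable_distortion hσ).mul hZ'm.aemeasurable.norm) ?_ hV hα.1
          filter_upwards [hV.distortion_nonneg hσ] with ω hω using mul_nonneg hω (norm_nonneg _)
  · have hpow : sigmaPow P σ q Z' ≤ (c : ℝ≥0∞) ^ q := by
      rw [sigmaPow_eq_rhoPow, rhoPow_eq_lintegral hσ hq.le hhm hV (Eventually.of_forall fun ω => by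
        rw [ENNReal.coe_inj, ← NNReal.coe_inj, coe_nnnorm, hnorm])]
      calc ∫⁻ u in Ioo (0 : ℝ) 1, ENNReal.ofReal (σ u) * (h u : ℝ≥0∞) ^ q
          = (c : ℝ≥0∞) ^ q * ∫⁻ u in Ioo (0 : ℝ) 1, ENNReal.ofReal (σ u) * (y u : ℝ≥0∞) ^ p := by
            rw [← lintegral_const_mul' _ _ (ENNReal.rpow_ne_top_of_nonneg hq.le ENNReal.coe_ne_top)]
            refine lintegral_congr fun u => ?_
            rw [hcoe, ENNReal.mul_rpow_of_nonneg _ _ hq.le, ← ENNReal.rpow_mul,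
              hpq.sub_one_mul_conj]
            ring
        _ ≤ _ := mul_le_of_le_one_right zero_le hy1
    calc sigmaNorm P σ q Z' ≤ ((c : ℝ≥0∞) ^ q) ^ (1 / q) :=
          ENNReal.rpow_le_rpow hpow (one_div_pos.2 hq).le
      _ = c := by rw [← ENNReal.rpow_mul, mul_one_div_cancel hq.ne', ENNReal.rpow_one]

lemma koetheNorm_le_dualNormQ {P : Measure Ω} [IsProbabilityMeasure P]
    (hrich : ∃ U : Ω → ℝ, IsUniformRV P U) {σ : ℝ → ℝ} (hσ : IsDistortion σ) {p q : ℝ}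
    (hpq : p.HolderConjugate q) {Z : Ω → 𝕂} (hZ : AEStronglyMeasurable Z P) :
    koetheNorm P σ p (fun ω => (‖Z ω‖₊ : ℝ≥0∞)) ≤ dualNormQ P σ q Z := by
  refine le_iInf₂ fun Z' hZ' => iSup₂_le fun X hX => ?_
  obtain ⟨hZ'm, U, hU, hdom⟩ := hZ'
  have hp := hpq.pos
  have hq := hpq.symm.pos
  have hσm := hσ.monotoneOn_ofReal
  obtain ⟨V, z, hV, hz, hzq, hZV⟩ := exists_comonotone hrich hZ.aemeasurable.nnnorm
  obtain ⟨VX, x, hVX, hx, -, hXV⟩ := exists_comonotone hrich hX.1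
  obtain ⟨W, hW, hκ, hkW⟩ := exists_comonotone_real hrich
    (g := fun ω => σ (U ω) * ‖Z' ω‖)
    ((hU.aemeasurable_distortion hσ).mul hZ'm.aemeasurable.norm)
    (by filter_upwards [hU.distortion_nonneg hσ] with ω hω; positivity)
  set κ : ℝ → ℝ≥0∞ := fun u => ENNReal.ofReal (quantileFn P (fun ω => σ (U ω) * ‖Z' ω‖) u) with hκd
  have hxW : AEMeasurable (fun ω => (x (W ω) : ℝ≥0∞)) P := hW.aemeasurable_comp hx.aemeasurable_Ioo
  have hσU : AEMeasurable (fun ω => ENNReal.ofReal (σ (U ω))) P :=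
    hU.aemeasurable_comp hσm.aemeasurable_Ioo
  have hxrho : rhoPow P σ p (fun ω => (x (W ω) : ℝ≥0∞)) ≤ 1 := by
    rw [rhoPow_eq_lintegral hσ hp.le hx hW (Eventually.of_forall fun _ => rfl),
      ← rhoPow_eq_lintegral hσ hp.le hx hVX (X := fun ω => (X ω : ℝ≥0∞))
        (by filter_upwards [hXV] with ω h; rw [h])]
    exact hX.2
  calc ∫⁻ ω, (‖Z ω‖₊ : ℝ≥0∞) * X ω ∂P
      = ∫⁻ ω, (‖Z ω‖₊ : ℝ≥0∞) * x (VX ω) ∂P := by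
        refine lintegral_congr_ae ?_
        filter_upwards [hXV] with ω h
        rw [h]
    _ ≤ ∫⁻ u in Ioo (0 : ℝ) 1, (z u : ℝ≥0∞) * x u :=
        lintegral_mul_comp_le hz hV (by filter_upwards [hZV] with ω h; rw [h]) hVX hx
    _ = ∫⁻ ω, (z (V ω) : ℝ≥0∞) * x (V ω) ∂P :=
        (hV.lintegral_comp (hz.mul_ennreal hx).aemeasurable_Ioo).symm
    _ ≤ ∫⁻ ω, κ (W ω) * x (W ω) ∂P := by
        refine lintegral_mul_comp_le_of_tail_le (f := fun u => (x u : ℝ≥0∞))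
          (hV.aemeasurable_comp hz.aemeasurable_Ioo)
          (hW.aemeasurable_comp hκ.aemeasurable_Ioo) hV hW (fun α hα => ?_) hx
        rw [hV.setLIntegral_comp hz.aemeasurable_Ioo hα.1,
          hW.setLIntegral_comp hκ.aemeasurable_Ioo hα.1]
        simp_rw [hzq]
        exact (avar_le_avar_iff hα.2).1 (hdom α hα)
    _ = ∫⁻ ω, (ENNReal.ofReal (σ (U ω)) ^ (1 / q) * (‖Z' ω‖₊ : ℝ≥0∞)) *
          (ENNReal.ofReal (σ (U ω)) ^ (1 / p) * x (W ω)) ∂P := by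
        refine lintegral_congr_ae ?_
        filter_upwards [hkW] with ω h
        have e : ENNReal.ofReal (σ (U ω)) ^ (1 / q) * ENNReal.ofReal (σ (U ω)) ^ (1 / p)
            = ENNReal.ofReal (σ (U ω)) := by
          rw [← ENNReal.rpow_add_of_nonneg _ _ (one_div_pos.2 hq).le (one_div_pos.2 hp).le,
            one_div, one_div, hpq.symm.inv_add_inv_eq_one, ENNReal.rpow_one]
        simp only [hκd]
        rw [← h, mul_mul_mul_comm, e, ENNReal.ofReal_mul' (norm_nonneg _), ofReal_norm,
          mul_assoc]
        rfl
    _ ≤ (∫⁻ ω, (ENNReal.ofReal (σ (U ω)) ^ (1 / q) * (‖Z' ω‖₊ : ℝ≥0∞)) ^ q ∂P) ^ (1 / q) *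
          (∫⁻ ω, (ENNReal.ofReal (σ (U ω)) ^ (1 / p) * x (W ω)) ^ p ∂P) ^ (1 / p) :=
        ENNReal.lintegral_mul_le_Lp_mul_Lq P hpq.symm
          ((hσU.pow_const _).mul hZ'm.aemeasurable.nnnorm.coe_nnreal_ennreal)
          ((hσU.pow_const _).mul hxW)
    _ ≤ sigmaNorm P σ q Z' * 1 := by
        have e : ∀ {r : ℝ} (_ : 0 < r) (a b : ℝ≥0∞), (a ^ (1 / r) * b) ^ r = a * b ^ r := by
          intro r hr a b
          rw [ENNReal.mul_rpow_of_nonneg _ _ hr.le, ← ENNReal.rpow_mul,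
            one_div_mul_cancel hr.ne', ENNReal.rpow_one]
        simp_rw [e hq, e hp]
        refine mul_le_mul' (ENNReal.rpow_le_rpow (le_rhoPow hU) (one_div_pos.2 hq).le) ?_
        exact ENNReal.rpow_le_one ((le_rhoPow hU).trans hxrho) (one_div_pos.2 hp).le
    _ = _ := mul_one _

theorem dualNormQ_eq_koetheNorm {P : Measure Ω} [IsProbabilityMeasure P]
    (hrich : ∃ U : Ω → ℝ, IsUniformRV P U) {σ : ℝ → ℝ} (hσ : IsDistortion σ) {p q : ℝ}
    (hpq : p.HolderConjugate q) {Z : Ω → 𝕂} (hZ : AEStronglyMeasurable Z P) :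
    dualNormQ P σ q Z = koetheNorm P σ p fun ω => (‖Z ω‖₊ : ℝ≥0∞) :=
  (dualNormQ_le_koetheNorm hrich hσ hpq hZ).antisymm (koetheNorm_le_dualNormQ hrich hσ hpq hZ)

/-! ### Norm axioms and completeness -/

section DualNorm

variable {P : Measure Ω} {σ : ℝ → ℝ} {p q : ℝ}

lemma quantileFn_const_mul {r : ℝ} (hr : 0 < r) (f : Ω → ℝ) (α : ℝ) :
    quantileFn P (fun ω => r * f ω) α = r * quantileFn P f α := by
  unfold quantileFn
  rw [← smul_eq_mul, ← Real.sInf_smul_of_nonneg hr.le]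
  congr 1
  ext s
  rw [Set.mem_smul_set_iff_inv_smul_mem₀ hr.ne']
  simp only [mem_ofPred_eq, smul_eq_mul]
  have : {ω | r * f ω ≤ s} = {ω | f ω ≤ r⁻¹ * s} := by
    ext ω
    simp only [mem_ofPred_eq]
    rw [← div_eq_inv_mul, le_div_iff₀' hr]
  rw [this]

lemma avar_const_mul {r : ℝ} (hr : 0 < r) (f : Ω → ℝ) (α : ℝ) :
    avar P (fun ω => r * f ω) α = ENNReal.ofReal r * avar P f α := by
  unfold avar
  simp_rw [quantileFn_const_mul hr, ENNReal.ofReal_mul hr.le]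
  rw [lintegral_const_mul' _ _ ENNReal.ofReal_ne_top]
  ring

lemma sigmaPow_const_smul {p : ℝ} (hp : 0 ≤ p) (c : 𝕂) (Y : Ω → 𝕂) :
    sigmaPow P σ p (c • Y) = (‖c‖₊ : ℝ≥0∞) ^ p * sigmaPow P σ p Y := by
  rw [sigmaPow_eq_rhoPow, sigmaPow_eq_rhoPow, ← rhoPow_const_mul hp ENNReal.coe_ne_top]
  congr 1
  funext ω
  simp

lemma sigmaNorm_const_smul {p : ℝ} (hp : 0 < p) (c : 𝕂) (Y : Ω → 𝕂) :
    sigmaNorm P σ p (c • Y) = (‖c‖₊ : ℝ≥0∞) * sigmaNorm P σ p Y := by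
  unfold sigmaNorm
  rw [sigmaPow_const_smul hp.le, ENNReal.mul_rpow_of_nonneg _ _ (one_div_pos.2 hp).le,
    ← ENNReal.rpow_mul, mul_one_div_cancel hp.ne', ENNReal.rpow_one]

lemma SigmaDominates.const_smul {Z' Z : Ω → 𝕂} (h : SigmaDominates P σ Z' Z) {c : 𝕂}
    (hc : c ≠ 0) : SigmaDominates P σ (c • Z') (c • Z) := by
  obtain ⟨U, hU, h⟩ := h
  refine ⟨U, hU, fun α hα => ?_⟩
  have hc' : 0 < ‖c‖ := norm_pos_iff.2 hc
  have e : (fun ω => σ (U ω) * ‖(c • Z') ω‖) = fun ω => ‖c‖ * (σ (U ω) * ‖Z' ω‖) := by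
    funext ω
    simp only [Pi.smul_apply, norm_smul]
    ring
  have e' : (fun ω => ‖(c • Z) ω‖) = fun ω => ‖c‖ * ‖Z ω‖ := by
    funext ω
    simp only [Pi.smul_apply, norm_smul]
  rw [e, e', avar_const_mul hc', avar_const_mul hc']
  exact mul_le_mul' le_rfl (h α hα)

lemma dualNormQ_const_smul_le (hq : 0 < q) {c : 𝕂} (hc : c ≠ 0) (Z : Ω → 𝕂) :
    dualNormQ P σ q (c • Z) ≤ (‖c‖₊ : ℝ≥0∞) * dualNormQ P σ q Z := by
  have hc0 : (‖c‖₊ : ℝ≥0∞) ≠ 0 := by simpa using hc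
  unfold dualNormQ
  simp_rw [ENNReal.mul_iInf_of_ne hc0 ENNReal.coe_ne_top]
  refine le_iInf₂ fun Z' hZ' => ?_
  rw [← sigmaNorm_const_smul hq]
  exact iInf₂_le (c • Z') ⟨hZ'.1.const_smul c, hZ'.2.const_smul hc⟩

variable [IsProbabilityMeasure P]

lemma dualNormQ_add_le (hrich : ∃ U : Ω → ℝ, IsUniformRV P U) (hσ : IsDistortion σ)
    (hpq : p.HolderConjugate q) {Z₁ Z₂ : Ω → 𝕂} (h₁ : AEStronglyMeasurable Z₁ P)
    (h₂ : AEStronglyMeasurable Z₂ P) :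
    dualNormQ P σ q (Z₁ + Z₂) ≤ dualNormQ P σ q Z₁ + dualNormQ P σ q Z₂ := by
  rw [dualNormQ_eq_koetheNorm hrich hσ hpq h₁, dualNormQ_eq_koetheNorm hrich hσ hpq h₂,
    dualNormQ_eq_koetheNorm hrich hσ hpq (h₁.add h₂)]
  refine (koetheNorm_mono (Eventually.of_forall fun ω => ?_)).trans
    (koetheNorm_add_le h₁.aemeasurable.nnnorm.coe_nnreal_ennreal)
  exact_mod_cast nnnorm_add_le (Z₁ ω) (Z₂ ω)

lemma dualNormQ_sub_le (hrich : ∃ U : Ω → ℝ, IsUniformRV P U) (hσ : IsDistortion σ)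
    (hpq : p.HolderConjugate q) {Z₁ Z₂ : Ω → 𝕂} (h₁ : AEStronglyMeasurable Z₁ P)
    (h₂ : AEStronglyMeasurable Z₂ P) :
    dualNormQ P σ q (Z₁ - Z₂) ≤ dualNormQ P σ q Z₁ + dualNormQ P σ q Z₂ := by
  rw [dualNormQ_eq_koetheNorm hrich hσ hpq h₁, dualNormQ_eq_koetheNorm hrich hσ hpq h₂,
    dualNormQ_eq_koetheNorm hrich hσ hpq (h₁.sub h₂)]
  refine (koetheNorm_mono (Eventually.of_forall fun ω => ?_)).trans
    (koetheNorm_add_le h₁.aemeasurable.nnnorm.coe_nnreal_ennreal)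
  exact_mod_cast nnnorm_sub_le (Z₁ ω) (Z₂ ω)

lemma dualNormQ_const_smul (hrich : ∃ U : Ω → ℝ, IsUniformRV P U) (hσ : IsDistortion σ)
    (hpq : p.HolderConjugate q) (c : 𝕂) (Z : Ω → 𝕂) :
    dualNormQ P σ q (c • Z) = (‖c‖₊ : ℝ≥0∞) * dualNormQ P σ q Z := by
  have hq := hpq.symm.pos
  rcases eq_or_ne c 0 with rfl | hc
  · rw [zero_smul, dualNormQ_eq_koetheNorm hrich hσ hpq aestronglyMeasurable_zero]
    simp [koetheNorm]
  refine le_antisymm (dualNormQ_const_smul_le hq hc Z) ?_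
  have h := dualNormQ_const_smul_le (P := P) (σ := σ) hq (inv_ne_zero hc) (c • Z)
  rw [inv_smul_smul₀ hc] at h
  calc (‖c‖₊ : ℝ≥0∞) * dualNormQ P σ q Z
      ≤ (‖c‖₊ : ℝ≥0∞) * ((‖c⁻¹‖₊ : ℝ≥0∞) * dualNormQ P σ q (c • Z)) := by gcongr
    _ = dualNormQ P σ q (c • Z) := by
      rw [← mul_assoc, ← ENNReal.coe_mul, nnnorm_inv, mul_inv_cancel₀ (by simpa using hc),
        ENNReal.coe_one, one_mul]

lemma eLpNorm_one_le_dualNormQ (hrich : ∃ U : Ω → ℝ, IsUniformRV P U) (hσ : IsDistortion σ)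
    (hpq : p.HolderConjugate q) {Z : Ω → 𝕂} (hZ : AEStronglyMeasurable Z P) :
    eLpNorm Z 1 P ≤ dualNormQ P σ q Z := by
  rw [dualNormQ_eq_koetheNorm hrich hσ hpq hZ, eLpNorm_one_eq_lintegral_enorm]
  exact lintegral_le_koetheNorm hrich hσ hpq.nonneg _

lemma ae_eq_zero_of_dualNormQ_eq_zero (hrich : ∃ U : Ω → ℝ, IsUniformRV P U)
    (hσ : IsDistortion σ) (hpq : p.HolderConjugate q) {Z : Ω → 𝕂}
    (hZ : AEStronglyMeasurable Z P) (h : dualNormQ P σ q Z = 0) : Z =ᵐ[P] 0 :=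
  (eLpNorm_eq_zero_iff hZ one_ne_zero).1
    (le_antisymm ((eLpNorm_one_le_dualNormQ hrich hσ hpq hZ).trans_eq h) zero_le)

lemma dualNormQ_complete (hrich : ∃ U : Ω → ℝ, IsUniformRV P U) (hσ : IsDistortion σ)
    (hpq : p.HolderConjugate q) (Zs : ℕ → Ω → 𝕂)
    (hZs : ∀ n, AEStronglyMeasurable (Zs n) P ∧ dualNormQ P σ q (Zs n) < ∞)
    (hcau : ∀ ε : ℝ≥0∞, 0 < ε → ∃ N : ℕ, ∀ m n : ℕ, N ≤ m → N ≤ n →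
      dualNormQ P σ q (Zs m - Zs n) < ε) :
    ∃ Z : Ω → 𝕂, AEStronglyMeasurable Z P ∧ dualNormQ P σ q Z < ∞ ∧
      Tendsto (fun n => dualNormQ P σ q (Zs n - Z)) atTop (𝓝 0) := by
  have hB0 : ∀ k : ℕ, (0 : ℝ≥0∞) < 2⁻¹ ^ k := fun k =>
    ENNReal.pow_pos (by simp) k
  choose N hN using fun k => hcau _ (hB0 k)
  set φ : ℕ → ℕ := fun k => k + ∑ j ∈ Finset.range (k + 1), N j with hφ
  have hφk : ∀ k, k ≤ φ k := fun k => Nat.le_add_right _ _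
  have hφN : ∀ {j k}, j ≤ k → N j ≤ φ k := fun {j k} h =>
    (Finset.single_le_sum (f := N) (fun _ _ => Nat.zero_le _)
      (Finset.mem_range.2 (Nat.lt_succ_of_le h))).trans (Nat.le_add_left _ _)
  have hlim : ∀ᵐ ω ∂P, ∃ l : 𝕂, Tendsto (fun k => Zs (φ k) ω) atTop (𝓝 l) := by
    refine Lp.ae_tendsto_of_cauchy_eLpNorm (p := 1) (B := fun k => 2⁻¹ ^ k)
      (fun k => (hZs _).1) le_rfl ?_ fun j n m hn hm => ?_
    · rw [ENNReal.tsum_geometric]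
      simp
    · exact (eLpNorm_one_le_dualNormQ hrich hσ hpq ((hZs _).1.sub (hZs _).1)).trans_lt
        (hN j _ _ (hφN hn) (hφN hm))
  obtain ⟨Z, hZm, hZlim⟩ := exists_stronglyMeasurable_limit_of_tendsto_ae
    (fun k => (hZs (φ k)).1) hlim
  have hZ := hZm.aestronglyMeasurable (μ := P)
  have hle : ∀ {ε : ℝ≥0∞} {M : ℕ}, (∀ m n, M ≤ m → M ≤ n → dualNormQ P σ q (Zs m - Zs n) < ε) →
      ∀ n, M ≤ n → dualNormQ P σ q (Zs n - Z) ≤ ε := by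
    intro ε M hM n hn
    rw [dualNormQ_eq_koetheNorm hrich hσ hpq ((hZs n).1.sub hZ)]
    refine (koetheNorm_le_liminf
      (gs := fun k ω => (‖(Zs n - Zs (φ k)) ω‖₊ : ℝ≥0∞)) (fun k => ?_) ?_).trans ?_
    · exact ((hZs n).1.sub (hZs _).1).aemeasurable.nnnorm.coe_nnreal_ennreal
    · filter_upwards [hZlim] with ω hω
      exact ENNReal.tendsto_coe.2 (tendsto_const_nhds.sub hω).nnnorm
    · refine liminf_le_of_frequently_le' (Eventually.frequently ?_)
      filter_upwards [eventually_ge_atTop M] with k hk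
      rw [← dualNormQ_eq_koetheNorm hrich hσ hpq ((hZs n).1.sub (hZs _).1)]
      exact (hM n (φ k) hn (hk.trans (hφk k))).le
  refine ⟨Z, hZ, ?_, ?_⟩
  · obtain ⟨M, hM⟩ := hcau 1 one_pos
    have h1 := dualNormQ_sub_le hrich hσ hpq (hZs M).1 ((hZs M).1.sub hZ)
    rw [sub_sub_cancel] at h1
    exact h1.trans_lt (ENNReal.add_lt_top.2
      ⟨(hZs M).2, (hle hM M le_rfl).trans_lt ENNReal.one_lt_top⟩)
  · rw [ENNReal.tendsto_atTop_zero]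
    intro ε hε
    obtain ⟨M, hM⟩ := hcau ε hε
    exact ⟨M, hle hM⟩

end DualNorm

/-! ### The pairing -/

/-- A measurable choice of `w` with `‖w‖ ≤ 1` and `z * w = ‖z‖`. -/
def conjPhase (z : 𝕂) : 𝕂 := conj z / (‖z‖ : 𝕂)

lemma mul_conjPhase (z : 𝕂) : z * conjPhase z = (‖z‖ : 𝕂) := by
  rcases eq_or_ne z 0 with rfl | hz
  · simp [conjPhase]
  have : (‖z‖ : 𝕂) ≠ 0 := by simpa using hz
  rw [conjPhase, ← mul_div_assoc, RCLike.mul_conj, pow_two, mul_div_assoc, div_self this, mul_one]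

lemma nnnorm_conjPhase_le (z : 𝕂) : ‖conjPhase z‖₊ ≤ 1 := by
  rw [← NNReal.coe_le_coe, coe_nnnorm, conjPhase, norm_div, RCLike.norm_conj, RCLike.norm_ofReal,
    abs_norm]
  exact div_self_le_one _

lemma aestronglyMeasurable_conjPhase_mul {P : Measure Ω} {Z : Ω → 𝕂}
    (hZ : AEStronglyMeasurable Z P) {X : Ω → ℝ≥0} (hX : AEMeasurable X P) :
    AEStronglyMeasurable (fun ω => conjPhase (Z ω) * (((X ω : ℝ≥0) : ℝ) : 𝕂)) P := by
  refine AEStronglyMeasurable.mul ?_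
    (RCLike.measurable_ofReal.comp_aemeasurable hX.coe_nnreal_real).aestronglyMeasurable
  exact ((RCLike.continuous_conj.measurable.comp_aemeasurable hZ.aemeasurable).div
    (RCLike.measurable_ofReal.comp_aemeasurable hZ.aemeasurable.norm)).aestronglyMeasurable

lemma nnnorm_conjPhase_mul_le (z : 𝕂) (x : ℝ≥0) : ‖conjPhase z * ((x : ℝ) : 𝕂)‖₊ ≤ x := by
  have : ‖((x : ℝ) : 𝕂)‖₊ = x := by
    rw [← NNReal.coe_inj, coe_nnnorm, RCLike.norm_ofReal, NNReal.abs_eq]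
  rw [nnnorm_mul, this]
  exact mul_le_of_le_one_left zero_le (nnnorm_conjPhase_le z)

lemma mul_conjPhase_mul (z : 𝕂) (x : ℝ≥0) :
    z * (conjPhase z * ((x : ℝ) : 𝕂)) = ((‖z‖ * x : ℝ) : 𝕂) := by
  rw [← mul_assoc, mul_conjPhase, RCLike.ofReal_mul]

section Pairing

variable {P : Measure Ω} {σ : ℝ → ℝ} {p : ℝ}

lemma memLsigma_of_le (hp : 0 ≤ p) {Y : Ω → 𝕂} (hY : AEStronglyMeasurable Y P) {X : Ω → ℝ≥0∞}
    (hle : ∀ᵐ ω ∂P, (‖Y ω‖₊ : ℝ≥0∞) ≤ X ω) (hX : rhoPow P σ p X < ⊤) : MemLsigma P σ p Y :=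
  ⟨hY, (rhoPow_mono hp hle).trans_lt hX⟩

lemma sigmaNorm_le_one (hp : 0 < p) {Y : Ω → 𝕂} {X : Ω → ℝ≥0∞}
    (hle : ∀ᵐ ω ∂P, (‖Y ω‖₊ : ℝ≥0∞) ≤ X ω) (hX : rhoPow P σ p X ≤ 1) : sigmaNorm P σ p Y ≤ 1 :=
  ENNReal.rpow_le_one ((rhoPow_mono hp.le hle).trans hX) (one_div_pos.2 hp).le

lemma integral_mul_conjPhase_mul (Z : Ω → 𝕂) (X : Ω → ℝ≥0) :
    ∫ ω, Z ω * (conjPhase (Z ω) * (((X ω : ℝ≥0) : ℝ) : 𝕂)) ∂P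
      = ((∫ ω, ‖Z ω‖ * X ω ∂P : ℝ) : 𝕂) := by
  simp_rw [mul_conjPhase_mul]
  exact integral_ofReal

lemma integral_norm_mul_eq_toReal {Z : Ω → 𝕂} (hZ : AEStronglyMeasurable Z P) {X : Ω → ℝ≥0}
    (hX : AEMeasurable X P) :
    ∫ ω, ‖Z ω‖ * X ω ∂P = (∫⁻ ω, (‖Z ω‖₊ : ℝ≥0∞) * X ω ∂P).toReal := by
  rw [integral_eq_lintegral_of_nonneg_ae (Eventually.of_forall fun ω => by positivity)
    (show AEMeasurable (fun ω => ‖Z ω‖ * (X ω : ℝ)) P from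
      hZ.aemeasurable.norm.mul hX.coe_nnreal_real).aestronglyMeasurable]
  congr 1
  refine lintegral_congr fun ω => ?_
  rw [ENNReal.ofReal_mul (norm_nonneg _), ENNReal.ofReal_coe_nnreal, ofReal_norm]
  rfl

variable [IsProbabilityMeasure P]

lemma lintegral_enorm_mul_le (hrich : ∃ U : Ω → ℝ, IsUniformRV P U) (hσ : IsDistortion σ)
    (hp : 0 < p) (Z : Ω → 𝕂) {Y : Ω → 𝕂} (hY : MemLsigma P σ p Y) :
    ∫⁻ ω, ‖Z ω * Y ω‖ₑ ∂P
      ≤ koetheNorm P σ p (fun ω => (‖Z ω‖₊ : ℝ≥0∞)) * sigmaNorm P σ p Y := by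
  have h := lintegral_mul_le_koetheNorm_mul hrich hσ hp (fun ω => (‖Z ω‖₊ : ℝ≥0∞))
    (X := fun ω => ‖Y ω‖₊) hY.1.aemeasurable.nnnorm hY.2.ne
  refine le_trans (le_of_eq (lintegral_congr fun ω => ?_)) h
  rw [enorm_mul]
  rfl

lemma integrable_mul_of_koetheNorm_ne_top (hrich : ∃ U : Ω → ℝ, IsUniformRV P U)
    (hσ : IsDistortion σ) (hp : 0 < p) {Z : Ω → 𝕂} (hZ : AEStronglyMeasurable Z P)
    (hfin : koetheNorm P σ p (fun ω => (‖Z ω‖₊ : ℝ≥0∞)) ≠ ⊤) {Y : Ω → 𝕂}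
    (hY : MemLsigma P σ p Y) : Integrable (fun ω => Z ω * Y ω) P := by
  refine ⟨hZ.mul hY.1, (lintegral_enorm_mul_le hrich hσ hp Z hY).trans_lt ?_⟩
  exact ENNReal.mul_lt_top hfin.lt_top
    (ENNReal.rpow_lt_top_of_nonneg (one_div_pos.2 hp).le hY.2.ne)

lemma ofReal_norm_integral_mul_le (hrich : ∃ U : Ω → ℝ, IsUniformRV P U) (hσ : IsDistortion σ)
    (hp : 0 < p) (Z : Ω → 𝕂) {Y : Ω → 𝕂} (hY : MemLsigma P σ p Y) :
    ENNReal.ofReal ‖∫ ω, Z ω * Y ω ∂P‖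
      ≤ koetheNorm P σ p (fun ω => (‖Z ω‖₊ : ℝ≥0∞)) * sigmaNorm P σ p Y := by
  rw [ofReal_norm]
  exact (enorm_integral_le_lintegral_enorm _).trans (lintegral_enorm_mul_le hrich hσ hp Z hY)

lemma koetheNorm_eq_iSup (hrich : ∃ U : Ω → ℝ, IsUniformRV P U)
    (hσ : IsDistortion σ) (hp : 0 < p) {Z : Ω → 𝕂} (hZ : AEStronglyMeasurable Z P)
    (hfin : koetheNorm P σ p (fun ω => (‖Z ω‖₊ : ℝ≥0∞)) ≠ ⊤) :
    koetheNorm P σ p (fun ω => (‖Z ω‖₊ : ℝ≥0∞))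
      = ⨆ (Y : Ω → 𝕂) (_ : MemLsigma P σ p Y ∧ sigmaNorm P σ p Y ≤ 1),
          ENNReal.ofReal ‖∫ ω, Z ω * Y ω ∂P‖ := by
  refine le_antisymm (iSup₂_le fun X hX => ?_) (iSup₂_le fun Y hY => ?_)
  · have hle : ∀ᵐ ω ∂P, (‖conjPhase (Z ω) * (((X ω : ℝ≥0) : ℝ) : 𝕂)‖₊ : ℝ≥0∞) ≤ X ω :=
      Eventually.of_forall fun ω => ENNReal.coe_le_coe.2 (nnnorm_conjPhase_mul_le _ _)
    refine le_iSup₂_of_le (fun ω => conjPhase (Z ω) * (((X ω : ℝ≥0) : ℝ) : 𝕂))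
      ⟨memLsigma_of_le hp.le (aestronglyMeasurable_conjPhase_mul hZ hX.1) hle
        (hX.2.trans_lt ENNReal.one_lt_top), sigmaNorm_le_one hp hle hX.2⟩ ?_
    rw [integral_mul_conjPhase_mul, integral_norm_mul_eq_toReal hZ hX.1, RCLike.norm_ofReal,
      abs_of_nonneg ENNReal.toReal_nonneg, ENNReal.ofReal_toReal]
    exact ne_top_of_le_ne_top hfin (le_koetheNorm hX.1 hX.2)
  · exact (ofReal_norm_integral_mul_le hrich hσ hp Z hY.1).trans (mul_le_of_le_one_right zero_le hY.2)

lemma ae_eq_of_integral_mul_eq {q : ℝ} (hrich : ∃ U : Ω → ℝ, IsUniformRV P U)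
    (hσ : IsDistortion σ) (hpq : p.HolderConjugate q) {Z₁ Z₂ : Ω → 𝕂}
    (h₁ : AEStronglyMeasurable Z₁ P) (h₂ : AEStronglyMeasurable Z₂ P)
    (hf₁ : dualNormQ P σ q Z₁ < ∞) (hf₂ : dualNormQ P σ q Z₂ < ∞)
    (h : ∀ Y : Ω → 𝕂, MemLsigma P σ p Y → ∫ ω, Z₁ ω * Y ω ∂P = ∫ ω, Z₂ ω * Y ω ∂P) :
    Z₁ =ᵐ[P] Z₂ := by
  have hp := hpq.pos
  have hfin : dualNormQ P σ q (Z₁ - Z₂) ≠ ⊤ :=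
    ne_top_of_le_ne_top (ENNReal.add_ne_top.2 ⟨hf₁.ne, hf₂.ne⟩) (dualNormQ_sub_le hrich hσ hpq h₁ h₂)
  have e := dualNormQ_eq_koetheNorm hrich hσ hpq (h₁.sub h₂)
  have h0 : dualNormQ P σ q (Z₁ - Z₂) = 0 := by
    rw [e] at hfin ⊢
    rw [koetheNorm_eq_iSup hrich hσ hp (h₁.sub h₂) hfin]
    rw [dualNormQ_eq_koetheNorm hrich hσ hpq h₁] at hf₁
    rw [dualNormQ_eq_koetheNorm hrich hσ hpq h₂] at hf₂
    simp only [ENNReal.iSup_eq_zero]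
    intro Y hY
    simp only [Pi.sub_apply, sub_mul]
    rw [integral_sub (integrable_mul_of_koetheNorm_ne_top hrich hσ hp h₁ hf₁.ne hY.1)
      (integrable_mul_of_koetheNorm_ne_top hrich hσ hp h₂ hf₂.ne hY.1), h Y hY.1]
    simp
  have := ae_eq_zero_of_dualNormQ_eq_zero hrich hσ hpq (h₁.sub h₂) h0
  filter_upwards [this] with ω hω
  exact sub_eq_zero.1 hω

end Pairing

/-! ### Representation of continuous functionals -/

/-- `φ` induces a continuous linear functional on `L_σ^p(P)`. -/
structure IsContFunctional (P : Measure Ω) (σ : ℝ → ℝ) (p : ℝ) (φ : (Ω → 𝕂) → 𝕂) : Prop where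
  map_add : ∀ Y₁ Y₂ : Ω → 𝕂, MemLsigma P σ p Y₁ → MemLsigma P σ p Y₂ →
    φ (Y₁ + Y₂) = φ Y₁ + φ Y₂
  map_smul : ∀ (c : 𝕂) (Y : Ω → 𝕂), MemLsigma P σ p Y → φ (c • Y) = c * φ Y
  congr_ae : ∀ Y₁ Y₂ : Ω → 𝕂, MemLsigma P σ p Y₁ → Y₁ =ᵐ[P] Y₂ → φ Y₁ = φ Y₂
  bound : ∃ C : ℝ, ∀ Y : Ω → 𝕂, MemLsigma P σ p Y → ‖φ Y‖ ≤ C * (sigmaNorm P σ p Y).toReal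

section Functional

variable {P : Measure Ω} [IsProbabilityMeasure P] {σ : ℝ → ℝ} {p : ℝ} {φ : (Ω → 𝕂) → 𝕂}

lemma memLsigma_of_bounded (hrich : ∃ U : Ω → ℝ, IsUniformRV P U) (hσ : IsDistortion σ)
    (hp : 0 ≤ p) {Y : Ω → 𝕂} (hY : AEStronglyMeasurable Y P) (c : ℝ≥0)
    (hc : ∀ᵐ ω ∂P, ‖Y ω‖₊ ≤ c) : MemLsigma P σ p Y := by
  refine memLsigma_of_le hp hY (X := fun _ => (c : ℝ≥0∞)) ?_ ?_
  · filter_upwards [hc] with ω h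
    exact_mod_cast h
  · rw [rhoPow_const hrich hσ hp ENNReal.coe_ne_top]
    exact ENNReal.rpow_lt_top_of_nonneg hp ENNReal.coe_ne_top

namespace IsContFunctional

lemma map_zero (hrich : ∃ U : Ω → ℝ, IsUniformRV P U) (hσ : IsDistortion σ) (hp : 0 ≤ p)
    (h : IsContFunctional P σ p φ) : φ 0 = 0 := by
  have h0 : MemLsigma P σ p (0 : Ω → 𝕂) :=
    memLsigma_of_bounded hrich hσ hp aestronglyMeasurable_zero 0 (by simp)
  simpa using h.map_smul 0 0 h0

/-- Dominated convergence for continuous functionals on `L_σ^p(P)`. -/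
lemma tendsto_of_dominated (hrich : ∃ U : Ω → ℝ, IsUniformRV P U) (hσ : IsDistortion σ)
    (hp : 0 < p) (h : IsContFunctional P σ p φ) {X : Ω → ℝ≥0} (hX : AEMeasurable X P)
    (hfin : rhoPow P σ p (fun ω => X ω) < ⊤) {Ys : ℕ → Ω → 𝕂} {Y : Ω → 𝕂}
    (hYs : ∀ n, AEStronglyMeasurable (Ys n) P) (hle : ∀ n, ∀ᵐ ω ∂P, ‖Ys n ω‖₊ ≤ X ω)
    (hlim : ∀ᵐ ω ∂P, Tendsto (fun n => Ys n ω) atTop (𝓝 (Y ω))) :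
    Tendsto (fun n => φ (Ys n)) atTop (𝓝 (φ Y)) := by
  have hYm : AEStronglyMeasurable Y P := aestronglyMeasurable_of_tendsto_ae _ hYs hlim
  have hYle : ∀ᵐ ω ∂P, ‖Y ω‖₊ ≤ X ω := by
    filter_upwards [ae_all_iff.2 hle, hlim] with ω h1 h2
    exact le_of_tendsto' h2.nnnorm h1
  have hYs' : ∀ n, MemLsigma P σ p (Ys n) := fun n => memLsigma_of_le hp.le (hYs n)
    ((hle n).mono fun ω hω => ENNReal.coe_le_coe.2 hω) hfin
  have hY : MemLsigma P σ p Y := memLsigma_of_le hp.le hYm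
    (hYle.mono fun ω hω => ENNReal.coe_le_coe.2 hω) hfin
  have hneg : MemLsigma P σ p ((-1 : 𝕂) • Y) := memLsigma_of_le hp.le (hYm.const_smul _)
    (hYle.mono fun ω hω => by simpa using hω) hfin
  have hX2 : rhoPow P σ p (fun ω => ((2 * X ω : ℝ≥0) : ℝ≥0∞)) ≠ ⊤ := by
    simp_rw [ENNReal.coe_mul]
    rw [rhoPow_const_mul hp.le ENNReal.coe_ne_top]
    exact ENNReal.mul_ne_top (ENNReal.rpow_ne_top_of_nonneg hp.le ENNReal.coe_ne_top) hfin.ne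
  have hdle : ∀ n, ∀ᵐ ω ∂P, ‖Ys n ω - Y ω‖₊ ≤ 2 * X ω := fun n => by
    filter_upwards [hle n, hYle] with ω h1 h2
    rw [two_mul]
    exact (nnnorm_sub_le _ _).trans (add_le_add h1 h2)
  have hrho := tendsto_rhoPow_zero hrich hσ hp (hX.const_mul 2) hX2
    (Xs := fun n ω => (‖Ys n ω - Y ω‖₊ : ℝ≥0∞))
    (fun n => ((hYs n).sub hYm).aemeasurable.nnnorm.coe_nnreal_ennreal)
    (fun n => (hdle n).mono fun ω hω => ENNReal.coe_le_coe.2 hω)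
    (by
      filter_upwards [hlim] with ω hω
      have := (tendsto_sub_nhds_zero_iff.2 hω).nnnorm
      rw [nnnorm_zero] at this
      exact ENNReal.tendsto_coe.2 this)
  have hdm : ∀ n, MemLsigma P σ p (Ys n + (-1 : 𝕂) • Y) := fun n =>
    memLsigma_of_le hp.le ((hYs n).add hneg.1) (X := fun ω => ((2 * X ω : ℝ≥0) : ℝ≥0∞))
      ((hdle n).mono fun ω hω => by
        simpa [sub_eq_add_neg] using ENNReal.coe_le_coe.2 hω) hX2.lt_top
  obtain ⟨C, hC⟩ := h.bound
  have hnorm : Tendsto (fun n => sigmaNorm P σ p (Ys n + (-1 : 𝕂) • Y)) atTop (𝓝 0) := by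
    have := (ENNReal.continuous_rpow_const (y := 1 / p)).tendsto 0 |>.comp hrho
    rw [ENNReal.zero_rpow_of_pos (one_div_pos.2 hp)] at this
    refine this.congr fun n => ?_
    rw [sigmaNorm, sigmaPow_eq_rhoPow]
    simp [sub_eq_add_neg]
  have hreal := (ENNReal.tendsto_toReal ENNReal.zero_ne_top).comp hnorm
  rw [ENNReal.toReal_zero] at hreal
  have hreal' := hreal.const_mul C
  rw [mul_zero] at hreal'
  refine tendsto_sub_nhds_zero_iff.1 (squeeze_zero_norm (fun n => ?_) hreal')
  have e : φ (Ys n) - φ Y = φ (Ys n + (-1 : 𝕂) • Y) := by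
    rw [h.map_add _ _ (hYs' n) hneg, h.map_smul _ _ hY]
    ring
  rw [e]
  exact hC _ (hdm n)

lemma map_sum {ι : Type*} (hrich : ∃ U : Ω → ℝ, IsUniformRV P U) (hσ : IsDistortion σ)
    (hp : 0 ≤ p) (h : IsContFunctional P σ p φ) {A : ι → Set Ω} (hA : ∀ i, MeasurableSet (A i))
    (hd : Pairwise (Function.onFun Disjoint A)) (s : Finset ι) :
    φ ((⋃ i ∈ s, A i).indicator 1) = ∑ i ∈ s, φ ((A i).indicator 1) := by
  classical
  have hmem : ∀ {B : Set Ω}, MeasurableSet B → MemLsigma P σ p (B.indicator (1 : Ω → 𝕂)) :=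
    fun {B} hB => memLsigma_of_bounded hrich hσ hp
      (aestronglyMeasurable_one.indicator hB) 1 (Eventually.of_forall fun ω => by
        by_cases hω : ω ∈ B <;> simp [hω])
  induction s using Finset.induction_on with
  | empty =>
    simp only [Finset.notMem_empty, iUnion_of_empty, iUnion_empty, Finset.sum_empty,
      indicator_empty']
    exact h.map_zero hrich hσ hp
  | insert a s ha ih =>
    have hdis : Disjoint (A a) (⋃ i ∈ s, A i) :=
      disjoint_iUnion₂_right.2 fun i hi => hd fun hai => ha (hai ▸ hi)
    rw [Finset.sum_insert ha, ← ih, Finset.set_biUnion_insert,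
      indicator_union_of_disjoint hdis]
    exact h.map_add _ _ (hmem (hA a)) (hmem (s.measurableSet_biUnion fun i _ => hA i))

open Classical in
/-- The vector measure `A ↦ φ(1_A)`. -/
def vectorMeasure (hrich : ∃ U : Ω → ℝ, IsUniformRV P U) (hσ : IsDistortion σ)
    (hp : 0 < p) (h : IsContFunctional P σ p φ) : VectorMeasure Ω 𝕂 where
  measureOf' A := if MeasurableSet A then φ (A.indicator 1) else 0
  empty' := by
    rw [if_pos MeasurableSet.empty, indicator_empty']
    exact h.map_zero hrich hσ hp.le
  not_measurable' A hA := if_neg hA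
  m_iUnion' A hA hd := by
    simp only [hA, MeasurableSet.iUnion hA, if_true]
    refine tendsto_of_seq_tendsto fun s hs => ?_
    have := h.tendsto_of_dominated hrich hσ hp (X := fun _ => 1) aemeasurable_const
      (by rw [rhoPow_const hrich hσ hp.le ENNReal.coe_ne_top]; simp)
      (Ys := fun n => (⋃ i ∈ s n, A i).indicator 1) (Y := (⋃ i, A i).indicator 1)
      (fun n => aestronglyMeasurable_one.indicator
        ((s n).measurableSet_biUnion fun i _ => hA i))
      (fun n => Eventually.of_forall fun ω => by
        by_cases hω : ω ∈ ⋃ i ∈ s n, A i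
        · rw [indicator_of_mem hω]; simp
        · rw [indicator_of_notMem hω]; simp)
      (Eventually.of_forall fun ω =>
        ((tendsto_indicator_biUnion_finset A (1 : Ω → 𝕂) ω).comp hs).mono_right (pure_le_nhds _))
    exact this.congr fun n => h.map_sum hrich hσ hp.le hA hd (s n)

lemma vectorMeasure_apply (hrich : ∃ U : Ω → ℝ, IsUniformRV P U) (hσ : IsDistortion σ)
    (hp : 0 < p) (h : IsContFunctional P σ p φ) {A : Set Ω} (hA : MeasurableSet A) :
    h.vectorMeasure hrich hσ hp A = φ (A.indicator 1) :=
  if_pos hA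

lemma vectorMeasure_eq_zero (hrich : ∃ U : Ω → ℝ, IsUniformRV P U) (hσ : IsDistortion σ)
    (hp : 0 < p) (h : IsContFunctional P σ p φ) {A : Set Ω} (hA : MeasurableSet A)
    (hA0 : P A = 0) : h.vectorMeasure hrich hσ hp A = 0 := by
  rw [h.vectorMeasure_apply hrich hσ hp hA, ← h.map_zero hrich hσ hp.le]
  refine (h.congr_ae 0 _ (memLsigma_of_bounded hrich hσ hp.le aestronglyMeasurable_zero 0
    (by simp)) ?_).symm
  exact (indicator_meas_zero hA0).symm

lemma exists_density (hrich : ∃ U : Ω → ℝ, IsUniformRV P U) (hσ : IsDistortion σ)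
    (hp : 0 < p) (h : IsContFunctional P σ p φ) :
    ∃ Z : Ω → 𝕂, Integrable Z P ∧
      ∀ A, MeasurableSet A → φ (A.indicator 1) = ∫ ω in A, Z ω ∂P := by
  set ν := h.vectorMeasure hrich hσ hp
  have key : ∀ f : 𝕂 →+ ℝ, Continuous f → ∃ g : Ω → ℝ, Integrable g P ∧
      ∀ A, MeasurableSet A → f (φ (A.indicator 1)) = ∫ ω in A, g ω ∂P := by
    intro f hf
    have hac : ν.mapRange f hf ≪ᵥ P.toENNRealVectorMeasure :=
      VectorMeasure.AbsolutelyContinuous.mk fun A hA hA0 => by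
        rw [Measure.toENNRealVectorMeasure_apply_measurable hA] at hA0
        rw [VectorMeasure.mapRange_apply, h.vectorMeasure_eq_zero hrich hσ hp hA hA0, f.map_zero]
    have hint := SignedMeasure.integrable_rnDeriv (ν.mapRange f hf) P
    refine ⟨_, hint, fun A hA => ?_⟩
    rw [← withDensityᵥ_apply hint hA, SignedMeasure.withDensityᵥ_rnDeriv_eq _ _ hac,
      VectorMeasure.mapRange_apply, h.vectorMeasure_apply hrich hσ hp hA]
  obtain ⟨g₁, hg₁, h₁⟩ := key RCLike.re RCLike.continuous_re
  obtain ⟨g₂, hg₂, h₂⟩ := key RCLike.im RCLike.continuous_im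
  refine ⟨fun ω => (g₁ ω : 𝕂) + (g₂ ω : 𝕂) * RCLike.I, hg₁.ofReal.add (hg₂.ofReal.mul_const _),
    fun A hA => ?_⟩
  have hi₁ : Integrable (fun ω => (g₁ ω : 𝕂)) (P.restrict A) := hg₁.ofReal.restrict
  have hi₂ : Integrable (fun ω => (g₂ ω : 𝕂) * RCLike.I) (P.restrict A) :=
    (hg₂.ofReal.mul_const _).restrict
  rw [integral_add hi₁ hi₂, integral_mul_const, integral_ofReal, integral_ofReal, ← h₁ A hA, ← h₂ A hA]
  exact (RCLike.re_add_im _).symm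

section Representation

variable {Z : Ω → 𝕂}

lemma eq_integral_simpleFunc (hrich : ∃ U : Ω → ℝ, IsUniformRV P U) (hσ : IsDistortion σ)
    (hp : 0 ≤ p) (h : IsContFunctional P σ p φ) (hZ : Integrable Z P)
    (hZφ : ∀ A, MeasurableSet A → φ (A.indicator 1) = ∫ ω in A, Z ω ∂P) (s : SimpleFunc Ω 𝕂) :
    φ s = ∫ ω, Z ω * s ω ∂P := by
  have hbd : ∀ s : SimpleFunc Ω 𝕂, ∃ c : ℝ≥0, ∀ ω, ‖s ω‖₊ ≤ c := fun s => by
    obtain ⟨c, hc⟩ := s.exists_forall_norm_le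
    exact ⟨c.toNNReal, fun ω => by
      rw [← norm_toNNReal]; exact Real.toNNReal_le_toNNReal (hc ω)⟩
  have hmem : ∀ s : SimpleFunc Ω 𝕂, MemLsigma P σ p s := fun s => by
    obtain ⟨c, hc⟩ := hbd s
    exact memLsigma_of_bounded hrich hσ hp s.aestronglyMeasurable c (Eventually.of_forall hc)
  have hint : ∀ s : SimpleFunc Ω 𝕂, Integrable (fun ω => Z ω * s ω) P := fun s => by
    obtain ⟨c, hc⟩ := s.exists_forall_norm_le
    exact hZ.mul_bdd s.aestronglyMeasurable (Eventually.of_forall hc)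
  induction s using SimpleFunc.induction with
  | const c hA =>
    rename_i A
    have e : ⇑(SimpleFunc.piecewise A hA (SimpleFunc.const Ω c) (SimpleFunc.const Ω 0))
        = c • A.indicator 1 := by
      funext ω
      by_cases hω : ω ∈ A <;> simp [hω]
    rw [e, h.map_smul, hZφ A hA, ← integral_indicator hA, ← integral_const_mul]
    · refine integral_congr_ae (Eventually.of_forall fun ω => ?_)
      by_cases hω : ω ∈ A <;> simp [hω, mul_comm]
    · exact memLsigma_of_bounded hrich hσ hp (aestronglyMeasurable_one.indicator hA) 1
        (Eventually.of_forall fun ω => by by_cases hω : ω ∈ A <;> simp [hω])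
  | add _ hf hg =>
    rename_i f g _
    rw [SimpleFunc.coe_add, h.map_add _ _ (hmem f) (hmem g), hf, hg,
      ← integral_add (hint f) (hint g)]
    simp only [Pi.add_apply, mul_add]

lemma eq_integral_of_bounded (hrich : ∃ U : Ω → ℝ, IsUniformRV P U) (hσ : IsDistortion σ)
    (hp : 0 < p) (h : IsContFunctional P σ p φ) (hZ : Integrable Z P)
    (hZφ : ∀ A, MeasurableSet A → φ (A.indicator 1) = ∫ ω in A, Z ω ∂P) {Y : Ω → 𝕂}
    (hY : AEStronglyMeasurable Y P) (c : ℝ≥0) (hc : ∀ᵐ ω ∂P, ‖Y ω‖₊ ≤ c) :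
    φ Y = ∫ ω, Z ω * Y ω ∂P := by
  obtain ⟨Y', hY', hYY'⟩ := hY
  have hYm := hY'.measurable
  set s : ℕ → SimpleFunc Ω 𝕂 := SimpleFunc.approxOn Y' hYm univ 0 (mem_univ _)
  have hs : ∀ ω, Tendsto (fun n => s n ω) atTop (𝓝 (Y' ω)) := fun ω =>
    SimpleFunc.tendsto_approxOn hYm (mem_univ _) (by simp)
  have hsle : ∀ n, ∀ᵐ ω ∂P, ‖s n ω‖₊ ≤ 2 * c := fun n => by
    filter_upwards [hc, hYY'] with ω h1 h2
    rw [h2] at h1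
    have := SimpleFunc.norm_approxOn_zero_le hYm (mem_univ (0 : 𝕂)) ω n
    rw [two_mul]
    exact (show ‖s n ω‖₊ ≤ ‖Y' ω‖₊ + ‖Y' ω‖₊ from this).trans (add_le_add h1 h1)
  have hφ := h.tendsto_of_dominated hrich hσ hp (X := fun _ => 2 * c) aemeasurable_const
    (by
      rw [rhoPow_const hrich hσ hp.le ENNReal.coe_ne_top]
      exact ENNReal.rpow_lt_top_of_nonneg hp.le ENNReal.coe_ne_top)
    (fun n => (s n).aestronglyMeasurable) hsle (Eventually.of_forall hs)
  have hI : Tendsto (fun n => ∫ ω, Z ω * s n ω ∂P) atTop (𝓝 (∫ ω, Z ω * Y' ω ∂P)) := by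
    refine tendsto_integral_of_dominated_convergence (fun ω => ‖Z ω‖ * (2 * c : ℝ≥0))
      (fun n => hZ.1.mul (s n).aestronglyMeasurable) (hZ.norm.mul_const _) (fun n => ?_)
      (Eventually.of_forall fun ω => (hs ω).const_mul _)
    filter_upwards [hsle n] with ω hω
    rw [norm_mul]
    exact mul_le_mul_of_nonneg_left (NNReal.coe_le_coe.2 hω) (norm_nonneg _)
  rw [h.congr_ae _ _ (memLsigma_of_bounded hrich hσ hp.le hY'.aestronglyMeasurable c
      (by filter_upwards [hc, hYY'] with ω h1 h2; rwa [← h2])) hYY'.symm |>.symm]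
  rw [integral_congr_ae (g := fun ω => Z ω * Y' ω) (hYY'.mono fun ω hω => by
    simp only [hω])]
  refine tendsto_nhds_unique hφ (hI.congr fun n => ?_)
  exact (h.eq_integral_simpleFunc hrich hσ hp.le hZ hZφ (s n)).symm

lemma koetheNorm_ne_top (hrich : ∃ U : Ω → ℝ, IsUniformRV P U) (hσ : IsDistortion σ)
    (hp : 0 < p) (h : IsContFunctional P σ p φ) (hZ : Integrable Z P)
    (hZφ : ∀ A, MeasurableSet A → φ (A.indicator 1) = ∫ ω in A, Z ω ∂P) :
    koetheNorm P σ p (fun ω => (‖Z ω‖₊ : ℝ≥0∞)) ≠ ⊤ := by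
  obtain ⟨C, hC⟩ := h.bound
  refine ne_top_of_le_ne_top (ENNReal.ofReal_ne_top (r := |C|)) (iSup₂_le fun X hX => ?_)
  have hXn : ∀ n : ℕ, AEMeasurable (fun ω => min (X ω) n) P := fun n =>
    hX.1.min aemeasurable_const
  have hbd : ∀ n : ℕ, ∫⁻ ω, (‖Z ω‖₊ : ℝ≥0∞) * (min (X ω) n : ℝ≥0) ∂P ≤ ENNReal.ofReal |C| := by
    intro n
    set Y : Ω → 𝕂 := fun ω => conjPhase (Z ω) * (((min (X ω) n : ℝ≥0) : ℝ) : 𝕂) with hYdef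
    have hYm : AEStronglyMeasurable Y P := aestronglyMeasurable_conjPhase_mul hZ.1 (hXn n)
    have hYle : ∀ ω, ‖Y ω‖₊ ≤ min (X ω) n := fun ω => nnnorm_conjPhase_mul_le _ _
    have hYX : ∀ᵐ ω ∂P, (‖Y ω‖₊ : ℝ≥0∞) ≤ X ω := Eventually.of_forall fun ω =>
      ENNReal.coe_le_coe.2 ((hYle ω).trans (min_le_left _ _))
    have hYn : ∀ᵐ ω ∂P, ‖Y ω‖₊ ≤ (n : ℝ≥0) := Eventually.of_forall fun ω =>
      (hYle ω).trans (min_le_right _ _)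
    have hY : MemLsigma P σ p Y := memLsigma_of_bounded hrich hσ hp.le hYm n hYn
    have hφY := h.eq_integral_of_bounded hrich hσ hp hZ hZφ hYm n hYn
    rw [hYdef, integral_mul_conjPhase_mul, integral_norm_mul_eq_toReal hZ.1 (hXn n), ← hYdef]
      at hφY
    have hfin : ∫⁻ ω, (‖Z ω‖₊ : ℝ≥0∞) * (min (X ω) n : ℝ≥0) ∂P ≠ ⊤ := by
      refine ne_top_of_le_ne_top (b := ∫⁻ ω, (‖Z ω‖₊ : ℝ≥0∞) * (n : ℝ≥0) ∂P) ?_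
        (lintegral_mono fun ω => by gcongr; exact min_le_right _ _)
      rw [lintegral_mul_const' _ _ ENNReal.coe_ne_top]
      exact ENNReal.mul_ne_top hZ.2.ne ENNReal.coe_ne_top
    rw [ENNReal.le_ofReal_iff_toReal_le hfin (abs_nonneg _)]
    have h1 := hC Y hY
    rw [hφY, RCLike.norm_ofReal, abs_of_nonneg ENNReal.toReal_nonneg] at h1
    have h2 : (sigmaNorm P σ p Y).toReal ≤ 1 := by
      simpa using ENNReal.toReal_mono ENNReal.one_ne_top (sigmaNorm_le_one hp hYX hX.2)
    calc _ ≤ C * (sigmaNorm P σ p Y).toReal := h1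
      _ ≤ |C| * 1 := mul_le_mul (le_abs_self C) h2 ENNReal.toReal_nonneg (abs_nonneg C)
      _ = |C| := mul_one _
  refine (lintegral_mono (g := fun ω => liminf
    (fun n : ℕ => (‖Z ω‖₊ : ℝ≥0∞) * (min (X ω) n : ℝ≥0)) atTop) fun ω => ?_).trans
    ((lintegral_liminf_le' fun n => hZ.1.aemeasurable.nnnorm.coe_nnreal_ennreal.mul
      (hXn n).coe_nnreal_ennreal).trans ?_)
  · refine (Tendsto.liminf_eq (tendsto_const_nhds.congr' ?_)).ge
    obtain ⟨N, hN⟩ := exists_nat_ge (X ω)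
    filter_upwards [eventually_ge_atTop N] with n hn
    rw [min_eq_left (hN.trans (Nat.cast_le.2 hn))]
  · exact liminf_le_of_frequently_le' (Eventually.of_forall hbd).frequently

lemma eq_integral (hrich : ∃ U : Ω → ℝ, IsUniformRV P U) (hσ : IsDistortion σ)
    (hp : 0 < p) (h : IsContFunctional P σ p φ) (hZ : Integrable Z P)
    (hZφ : ∀ A, MeasurableSet A → φ (A.indicator 1) = ∫ ω in A, Z ω ∂P) {Y : Ω → 𝕂}
    (hY : MemLsigma P σ p Y) : φ Y = ∫ ω, Z ω * Y ω ∂P := by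
  have hint := integrable_mul_of_koetheNorm_ne_top hrich hσ hp hZ.1
    (h.koetheNorm_ne_top hrich hσ hp hZ hZφ) hY
  set Ys : ℕ → Ω → 𝕂 := fun n ω => if ‖hY.1.mk Y ω‖ ≤ n then Y ω else 0
  have hYs : ∀ n, AEStronglyMeasurable (Ys n) P := fun n => by
    have hA : MeasurableSet {ω | ‖hY.1.mk Y ω‖ ≤ n} :=
      measurableSet_le hY.1.stronglyMeasurable_mk.norm.measurable measurable_const
    exact (hY.1.indicator hA).congr (Eventually.of_forall fun ω => by
      simp only [Ys, indicator_apply, mem_ofPred_eq])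
  have hle : ∀ n ω, ‖Ys n ω‖₊ ≤ ‖Y ω‖₊ := fun n ω => by
    simp only [Ys]
    split_ifs <;> simp
  have hlim : ∀ ω, Tendsto (fun n => Ys n ω) atTop (𝓝 (Y ω)) := fun ω => by
    refine tendsto_const_nhds.congr' ?_
    obtain ⟨N, hN⟩ := exists_nat_ge ‖hY.1.mk Y ω‖
    filter_upwards [eventually_ge_atTop N] with n hn
    exact (if_pos (hN.trans (Nat.cast_le.2 hn))).symm
  have hbd : ∀ n : ℕ, ∀ᵐ ω ∂P, ‖Ys n ω‖₊ ≤ (n : ℝ≥0) := fun n => by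
    filter_upwards [hY.1.ae_eq_mk] with ω hω
    simp only [Ys, ← hω]
    split_ifs with h1
    · exact_mod_cast h1
    · simp
  have hφ := h.tendsto_of_dominated hrich hσ hp (X := fun ω => ‖Y ω‖₊) hY.1.aemeasurable.nnnorm
    hY.2 hYs (fun n => Eventually.of_forall (hle n)) (Eventually.of_forall hlim)
  refine tendsto_nhds_unique hφ ?_
  simp_rw [fun n => h.eq_integral_of_bounded hrich hσ hp hZ hZφ (hYs n) n (hbd n)]
  refine tendsto_integral_of_dominated_convergence (fun ω => ‖Z ω * Y ω‖)
    (fun n => hZ.1.mul (hYs n)) hint.norm (fun n => Eventually.of_forall fun ω => ?_)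
    (Eventually.of_forall fun ω => (hlim ω).const_mul _)
  rw [norm_mul, norm_mul]
  exact mul_le_mul_of_nonneg_left (hle n ω) (norm_nonneg _)

end Representation

end IsContFunctional

/-- The norm of the functional represented by `Z` is attained. -/
lemma exists_norming {q : ℝ} (hrich : ∃ U : Ω → ℝ, IsUniformRV P U) (hσ : IsDistortion σ)
    (hpq : p.HolderConjugate q) {Z : Ω → 𝕂} (hZ : AEStronglyMeasurable Z P)
    (hfin : koetheNorm P σ p (fun ω => (‖Z ω‖₊ : ℝ≥0∞)) ≠ ⊤) :
    ∃ Y : Ω → 𝕂, MemLsigma P σ p Y ∧ sigmaNorm P σ p Y = 1 ∧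
      ∫ ω, Z ω * Y ω ∂P
        = ((koetheNorm P σ p (fun ω => (‖Z ω‖₊ : ℝ≥0∞))).toReal : 𝕂) := by
  have hp := hpq.pos
  set N := koetheNorm P σ p (fun ω => (‖Z ω‖₊ : ℝ≥0∞)) with hN
  rcases eq_or_ne N 0 with h0 | h0
  · have hY : MemLsigma P σ p (1 : Ω → 𝕂) := memLsigma_of_bounded hrich hσ hp.le
      aestronglyMeasurable_one 1 (by simp)
    refine ⟨1, hY, ?_, ?_⟩
    · rw [sigmaNorm, sigmaPow_eq_rhoPow]
      simp only [Pi.one_apply, nnnorm_one, ENNReal.coe_one]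
      rw [rhoPow_const hrich hσ hp.le ENNReal.one_ne_top, ENNReal.one_rpow, ENNReal.one_rpow]
    · have := ofReal_norm_integral_mul_le hrich hσ hp Z hY
      rw [← hN, h0, zero_mul, nonpos_iff_eq_zero, ENNReal.ofReal_eq_zero] at this
      rw [h0, norm_le_zero_iff.1 this]
      simp
  obtain ⟨V, z, hV, hz, -, hZV⟩ := exists_comonotone hrich hZ.aemeasurable.nnnorm
  obtain ⟨y, hy, hy1, hzy⟩ := exists_maximizer hrich hσ hpq hZ.aemeasurable.nnnorm hV hz hZV hfin
  have hyV : AEMeasurable (fun ω => y (V ω)) P := hV.aemeasurable_comp_nnreal hy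
  have hrho : rhoPow P σ p (fun ω => (y (V ω) : ℝ≥0∞)) ≤ 1 := by
    rw [rhoPow_eq_lintegral hσ hp.le hy hV (Eventually.of_forall fun ω => rfl)]
    exact hy1
  have hle : ∀ᵐ ω ∂P, (‖conjPhase (Z ω) * (((y (V ω) : ℝ≥0) : ℝ) : 𝕂)‖₊ : ℝ≥0∞) ≤ y (V ω) :=
    Eventually.of_forall fun ω => ENNReal.coe_le_coe.2 (nnnorm_conjPhase_mul_le _ _)
  have hY := memLsigma_of_le hp.le (aestronglyMeasurable_conjPhase_mul hZ hyV) hle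
    (hrho.trans_lt ENNReal.one_lt_top)
  have hY1 := sigmaNorm_le_one hp hle hrho
  have hval : ∫⁻ ω, (‖Z ω‖₊ : ℝ≥0∞) * y (V ω) ∂P = N := by
    rw [hN, ← hzy, ← hV.lintegral_comp (hz.mul_ennreal hy).aemeasurable_Ioo]
    refine lintegral_congr_ae ?_
    filter_upwards [hZV] with ω hω
    rw [hω]
  have hI : ∫ ω, Z ω * (conjPhase (Z ω) * (((y (V ω) : ℝ≥0) : ℝ) : 𝕂)) ∂P = (N.toReal : 𝕂) := by
    rw [integral_mul_conjPhase_mul, integral_norm_mul_eq_toReal hZ hyV, hval]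
  refine ⟨_, hY, hY1.antisymm ?_, hI⟩
  have h1 := ofReal_norm_integral_mul_le hrich hσ hp Z hY
  rw [hI, RCLike.norm_ofReal, abs_of_nonneg ENNReal.toReal_nonneg, ENNReal.ofReal_toReal hfin,
    ← hN] at h1
  by_contra! hlt
  refine absurd h1 (not_le.2 ?_)
  calc N * _ < N * 1 := ENNReal.mul_lt_mul_right h0 hfin hlt
    _ = N := mul_one N

end Functional

end Auxiliary

/-- For `p ∈ (1,∞)` with conjugate exponent `q`: `|·|*_{σ,q}` is a
norm on `L*_{σ,q}(P)` turning it into a Banach space; `Φ(Z)(Y) := E(ZY)` is an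
isometric isomorphism from `(L*_{σ,q}(P), |·|*_{σ,q})` onto the continuous dual of
`L_σ^p(P)`; and every continuous linear functional on `L_σ^p(P)` attains its norm. -/
theorem statement16
    (P : Measure Ω) [IsProbabilityMeasure P]
    (hrich : ∃ U : Ω → ℝ, IsUniformRV P U)
    {𝕂 : Type*} [RCLike 𝕂]
    (σ : ℝ → ℝ) (hσ : IsDistortion σ)
    (p q : ℝ) (hp : 1 < p) (hq : 1 / p + 1 / q = 1) :
    -- `|·|*_{σ,q}` is a norm on `L*_{σ,q}(P)`
    (∀ Z₁ Z₂ : Ω → 𝕂, AEStronglyMeasurable Z₁ P → AEStronglyMeasurable Z₂ P →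
      dualNormQ P σ q (Z₁ + Z₂) ≤ dualNormQ P σ q Z₁ + dualNormQ P σ q Z₂) ∧
    (∀ (c : 𝕂) (Z : Ω → 𝕂),
      dualNormQ P σ q (c • Z) = (‖c‖₊ : ℝ≥0∞) * dualNormQ P σ q Z) ∧
    (∀ Z : Ω → 𝕂, AEStronglyMeasurable Z P → dualNormQ P σ q Z = 0 → Z =ᵐ[P] 0) ∧
    -- completeness of `(L*_{σ,q}(P), |·|*_{σ,q})`
    (∀ Zs : ℕ → Ω → 𝕂,
      (∀ n, AEStronglyMeasurable (Zs n) P ∧ dualNormQ P σ q (Zs n) < ∞) →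
      (∀ ε : ℝ≥0∞, 0 < ε → ∃ N : ℕ, ∀ m n : ℕ, N ≤ m → N ≤ n →
        dualNormQ P σ q (Zs m - Zs n) < ε) →
      ∃ Z : Ω → 𝕂, AEStronglyMeasurable Z P ∧ dualNormQ P σ q Z < ∞ ∧
        Filter.Tendsto (fun n => dualNormQ P σ q (Zs n - Z)) Filter.atTop (nhds 0)) ∧
    -- `Φ(Z)` is a continuous linear functional on `L_σ^p(P)` and `Φ` is isometric
    (∀ Z : Ω → 𝕂, AEStronglyMeasurable Z P → dualNormQ P σ q Z < ∞ →
      (∀ Y : Ω → 𝕂, MemLsigma P σ p Y → Integrable (fun ω => Z ω * Y ω) P) ∧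
      dualNormQ P σ q Z
        = ⨆ (Y : Ω → 𝕂) (_ : MemLsigma P σ p Y ∧ sigmaNorm P σ p Y ≤ 1),
            ENNReal.ofReal ‖∫ ω, Z ω * Y ω ∂P‖) ∧
    -- `Φ` is injective
    (∀ Z₁ Z₂ : Ω → 𝕂, AEStronglyMeasurable Z₁ P → AEStronglyMeasurable Z₂ P →
      dualNormQ P σ q Z₁ < ∞ → dualNormQ P σ q Z₂ < ∞ →
      (∀ Y : Ω → 𝕂, MemLsigma P σ p Y → ∫ ω, Z₁ ω * Y ω ∂P = ∫ ω, Z₂ ω * Y ω ∂P) →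
      Z₁ =ᵐ[P] Z₂) ∧
    -- `Φ` is surjective onto the continuous dual of `L_σ^p(P)`, and every continuous
    -- linear functional attains its norm at some `Y` with `‖Y‖_{σ,p} = 1`
    (∀ φ : (Ω → 𝕂) → 𝕂,
      (∀ Y₁ Y₂ : Ω → 𝕂, MemLsigma P σ p Y₁ → MemLsigma P σ p Y₂ →
        φ (Y₁ + Y₂) = φ Y₁ + φ Y₂) →
      (∀ (c : 𝕂) (Y : Ω → 𝕂), MemLsigma P σ p Y → φ (c • Y) = c * φ Y) →
      (∀ Y₁ Y₂ : Ω → 𝕂, MemLsigma P σ p Y₁ → Y₁ =ᵐ[P] Y₂ → φ Y₁ = φ Y₂) →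
      (∃ C : ℝ, ∀ Y : Ω → 𝕂, MemLsigma P σ p Y →
        ‖φ Y‖ ≤ C * (sigmaNorm P σ p Y).toReal) →
      (∃ Z : Ω → 𝕂, AEStronglyMeasurable Z P ∧ dualNormQ P σ q Z < ∞ ∧
        ∀ Y : Ω → 𝕂, MemLsigma P σ p Y → φ Y = ∫ ω, Z ω * Y ω ∂P) ∧
      (∃ Y : Ω → 𝕂, MemLsigma P σ p Y ∧ sigmaNorm P σ p Y = 1 ∧
        φ Y = ((sSup {r : ℝ | ∃ Y' : Ω → 𝕂, MemLsigma P σ p Y' ∧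
          sigmaNorm P σ p Y' ≤ 1 ∧ r = ‖φ Y'‖} : ℝ) : 𝕂))) := by
  have hp0 : 0 < p := one_pos.trans hp
  have hpq : p.HolderConjugate q :=
    Real.holderConjugate_iff.2 ⟨hp, by rw [← one_div, ← one_div]; exact hq⟩
  have hnorm : ∀ {Z : Ω → 𝕂}, AEStronglyMeasurable Z P →
      dualNormQ P σ q Z = koetheNorm P σ p fun ω => (‖Z ω‖₊ : ℝ≥0∞) :=
    fun hZ => dualNormQ_eq_koetheNorm hrich hσ hpq hZ
  refine ⟨fun Z₁ Z₂ h₁ h₂ => dualNormQ_add_le hrich hσ hpq h₁ h₂,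
    dualNormQ_const_smul hrich hσ hpq,
    fun Z hZ h => ae_eq_zero_of_dualNormQ_eq_zero hrich hσ hpq hZ h,
    dualNormQ_complete hrich hσ hpq, fun Z hZ hfin => ?_,
    fun Z₁ Z₂ => ae_eq_of_integral_mul_eq hrich hσ hpq, fun φ hadd hsmul hcongr hbound => ?_⟩
  · rw [hnorm hZ] at hfin ⊢
    exact ⟨fun Y hY => integrable_mul_of_koetheNorm_ne_top hrich hσ hp0 hZ hfin.ne hY,
      koetheNorm_eq_iSup hrich hσ hp0 hZ hfin.ne⟩
  · have h : IsContFunctional P σ p φ := ⟨hadd, hsmul, hcongr, hbound⟩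
    obtain ⟨Z, hZ, hZφ⟩ := h.exists_density hrich hσ hp0
    have hfin := h.koetheNorm_ne_top hrich hσ hp0 hZ hZφ
    have hrep : ∀ Y : Ω → 𝕂, MemLsigma P σ p Y → φ Y = ∫ ω, Z ω * Y ω ∂P :=
      fun Y hY => h.eq_integral hrich hσ hp0 hZ hZφ hY
    refine ⟨⟨Z, hZ.1, by rw [hnorm hZ.1]; exact hfin.lt_top, hrep⟩, ?_⟩
    obtain ⟨Y, hY, hY1, hYZ⟩ := exists_norming hrich hσ hpq hZ.1 hfin
    refine ⟨Y, hY, hY1, ?_⟩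
    rw [hrep Y hY, hYZ]
    congr 1
    refine (IsGreatest.csSup_eq (And.intro ?_ ?_)).symm
    · refine ⟨Y, hY, hY1.le, ?_⟩
      rw [hrep Y hY, hYZ, RCLike.norm_ofReal, abs_of_nonneg ENNReal.toReal_nonneg]
    · rintro _ ⟨Y', hY', hY'1, rfl⟩
      rw [hrep Y' hY', ← ENNReal.ofReal_le_iff_le_toReal hfin]
      exact (ofReal_norm_integral_mul_le hrich hσ hp0 Z hY').trans
        (mul_le_of_le_one_right zero_le hY'1)

end
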